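/- For every integer r ≥ 3 there exists a constant C(r) > 0 such that for every prime p, every nonprincipal Dirichlet character χ modulo p, and every real x ≥ 2, one has | ∑_{m ≤ x} μ²(m)·χ(m) | ≤ C(r) · x^{1−1/r} · p^{(r+1)/(4r²)} · (log p)^{1/(2r)}. -/

import Mathlib

open Polynomial in
theorem sum_mul_X_pow_mul_pow_eq_zero {F : Type*} [Field F] {s U : ℕ} {b : ℕ → F[X]}
    {e c : ℕ → ℕ} {g : F[X]} (he : ∀ u v, u < v → e u + s ≤ e v)
    (hb : ∀ u, (b u).degree < s) (hg : g.eval 0 ≠ 0)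
    (h : ∑ u ∈ Finset.range U, b u * X ^ e u * g ^ c u = 0) (u : ℕ) (hu : u < U) : b u = 0 := by
  induction u using Nat.strong_induction_on with
  | _ u ih =>
  have hsplit := Finset.add_sum_erase (Finset.range U) (fun u => b u * X ^ e u * g ^ c u)
    (Finset.mem_range.2 hu)
  rw [h] at hsplit
  have hdvd : X ^ (e u + s) ∣ b u * X ^ e u * g ^ c u := by
    rw [eq_neg_of_add_eq_zero_left hsplit, dvd_neg]
    refine Finset.dvd_sum fun v hv => ?_
    rw [Finset.mem_erase, Finset.mem_range] at hv
    rcases lt_or_gt_of_ne hv.1 with hlt | hlt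
    · simp [ih v hlt hv.2]
    · exact ((pow_dvd_pow _ (he u v hlt)).mul_left _).mul_right _
  rw [pow_add, mul_right_comm, mul_comm _ (X ^ e u), mul_dvd_mul_iff_left
    (pow_ne_zero _ X_ne_zero)] at hdvd
  have hcop : IsCoprime (X ^ s : F[X]) (g ^ c u) := by
    apply IsCoprime.pow
    rw [(irreducible_X).coprime_iff_not_dvd, X_dvd_iff, coeff_zero_eq_eval_zero]
    exact hg
  have := hcop.dvd_of_dvd_mul_right hdvd
  by_contra hne
  have h1 := degree_le_of_dvd this hne
  rw [degree_X_pow] at h1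
  exact absurd (hb u) (not_lt.2 h1)

open Polynomial in
theorem card_filter_eval_pow_eq_le {p : ℕ} [Fact p.Prime] {F : Type*} [Field F] [Fintype F]
    [DecidableEq F] [CharP F p] {k d s Q m : ℕ} (hQ : Q = p ^ k) (hF : Fintype.card F = Q ^ 2)
    (hd : 2 ≤ d) (hds : d * s + 1 = Q) {g : F[X]} (hg : g.eval 0 ≠ 0)
    (hm : (X * g).natDegree ≤ m) (hmQ : m + 1 < Q) (a : F) :
    (Finset.univ.filter fun x : F => (X * g).eval x ≠ 0 ∧
      (X * g).eval x ^ (s * (Q + 1)) = a).card ≤ s * (Q + 1) + 2 * m * Q := by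
  classical
  set f := X * g with hf
  have hs : 0 < s := by
    rcases Nat.eq_zero_or_pos s with rfl | h
    · omega
    · exact h
  set J := s + m + 1 with hJ
  set U := d * J with hU
  set D := Q * (s - 1) + J + m * (Q - 1) with hD
  -- the map from coefficient families to the reduced polynomial
  let H : (Fin U → degreeLT F s) → F[X] := fun b =>
    ∑ u, (b u : F[X]) ^ Q * X ^ ((u : ℕ) / d) * C a ^ ((u : ℕ) % d) * f ^ ((d - (u : ℕ) % d) * s)
  have hHdeg : ∀ b, H b ∈ degreeLT F D := by
    intro b
    refine Submodule.sum_mem _ fun u _ => ?_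
    rw [mem_degreeLT]
    have hb : (b u : F[X]).natDegree ≤ s - 1 := by
      have := mem_degreeLT.1 (b u).2
      by_cases h0 : (b u : F[X]) = 0
      · simp [h0]
      · have := (natDegree_lt_iff_degree_lt h0).2 this
        omega
    have h1 : ((b u : F[X]) ^ Q * X ^ ((u : ℕ) / d) * C a ^ ((u : ℕ) % d) *
        f ^ ((d - (u : ℕ) % d) * s)).natDegree ≤ Q * (s - 1) + (J - 1) + 0 + (Q - 1) * m := by
      refine natDegree_mul_le_of_le (natDegree_mul_le_of_le (natDegree_mul_le_of_le
        (natDegree_pow_le_of_le _ hb) ?_) ?_) ?_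
      · rw [natDegree_X_pow]
        have : (u : ℕ) / d < J := Nat.div_lt_of_lt_mul (u.2.trans_eq hU)
        omega
      · rw [← C_pow, natDegree_C]
      · refine (natDegree_pow_le_of_le _ hm).trans (Nat.mul_le_mul_right _ ?_)
        have : (d - (u : ℕ) % d) * s ≤ d * s := Nat.mul_le_mul_right _ (Nat.sub_le _ _)
        omega
    refine lt_of_le_of_lt (degree_le_of_natDegree_le h1) ?_
    rw [Nat.cast_lt, hD, mul_comm (Q - 1) m]
    omega
  have hsub : ∀ b b', H (b - b') = H b - H b' := by
    intro b b'
    simp only [H, ← Finset.sum_sub_distrib]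
    refine Finset.sum_congr rfl fun u _ => ?_
    have : ((b u : F[X]) - (b' u : F[X])) ^ Q = (b u : F[X]) ^ Q - (b' u : F[X]) ^ Q := by
      rw [hQ, sub_pow_char_pow]
    simp only [Pi.sub_apply, AddSubgroupClass.coe_sub, this]
    ring
  have hcard : ∀ n : ℕ, Nat.card (degreeLT F n) = Fintype.card F ^ n := by
    intro n
    rw [Nat.card_congr (degreeLTEquiv F n).toEquiv]
    simp
  have hfin : ∀ n : ℕ, Finite (degreeLT F n) := fun n =>
    Finite.of_equiv _ (degreeLTEquiv F n).toEquiv.symm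
  have hlt : D < s * U := by
    have h1 : s * U = (Q - 1) * J := by rw [hU, ← hds]; simp; ring
    have h2 : 2 * s + 1 ≤ Q := by nlinarith
    rw [h1, hD, hJ]
    obtain ⟨q, rfl⟩ : ∃ q, Q = q + 1 := ⟨Q - 1, by omega⟩
    obtain ⟨t, rfl⟩ : ∃ t, s = t + 1 := ⟨s - 1, by omega⟩
    simp only [Nat.add_sub_cancel]
    nlinarith
  obtain ⟨b, hb0, hbH⟩ : ∃ b : Fin U → degreeLT F s, b ≠ 0 ∧ H b = 0 := by
    have : ¬ Function.Injective (fun b => (⟨H b, hHdeg b⟩ : degreeLT F D)) := by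
      intro hinj
      have h1 := Nat.card_le_card_of_injective _ hinj
      rw [Nat.card_pi, Finset.prod_const, hcard, hcard, ← pow_mul, Finset.card_univ,
        Fintype.card_fin] at h1
      exact absurd h1 (not_le.2 (Nat.pow_lt_pow_right Fintype.one_lt_card hlt))
    simp only [Function.Injective, not_forall] at this
    obtain ⟨b, b', h1, h2⟩ := this
    refine ⟨b - b', sub_ne_zero.2 h2, ?_⟩
    rw [hsub, sub_eq_zero]
    exact congrArg Subtype.val h1
  let G : F[X] := ∑ u : Fin U, (b u : F[X]) * X ^ ((u : ℕ) / d * Q) * f ^ ((u : ℕ) % d * s)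
  have hG : G ≠ 0 := by
    intro hG0
    apply hb0
    let b' : ℕ → F[X] := fun u => if h : u < U then (b ⟨u, h⟩ : F[X]) else 0
    have key := sum_mul_X_pow_mul_pow_eq_zero (s := s) (U := U) (b := b')
      (e := fun u => s * u + u / d) (c := fun u => u % d * s) (g := g) ?_ ?_ hg ?_
    · ext1 u
      have := key u u.2
      simp only [b', u.2, dif_pos, Fin.eta] at this
      exact Subtype.ext this
    · intro u v huv
      have : u / d ≤ v / d := Nat.div_le_div_right huv.le
      have : s * (u + 1) ≤ s * v := Nat.mul_le_mul_left _ huv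
      change s * u + u / d + s ≤ s * v + v / d
      linarith
    · intro u
      by_cases h : u < U
      · simp only [b', h, dif_pos]
        exact mem_degreeLT.1 (b ⟨u, h⟩).2
      · simp only [b', h, dif_neg, not_false_eq_true, degree_zero]
        exact WithBot.bot_lt_coe _
    · rw [← hG0, Finset.sum_range]
      refine Finset.sum_congr rfl fun u _ => ?_
      simp only [b', u.2, dif_pos, Fin.eta]
      have : s * (u : ℕ) + u / d = (u : ℕ) / d * Q + u % d * s := by
        rw [← hds]
        nlinarith [Nat.div_add_mod (u : ℕ) d]
      rw [this, hf, mul_pow, pow_add]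
      ring
  have hGdeg : G.natDegree ≤ s * (Q + 1) + 2 * m * Q := by
    refine natDegree_sum_le_of_forall_le _ _ fun u _ => ?_
    have hb : (b u : F[X]).natDegree ≤ s - 1 := by
      have := mem_degreeLT.1 (b u).2
      by_cases h0 : (b u : F[X]) = 0
      · simp [h0]
      · have := (natDegree_lt_iff_degree_lt h0).2 this
        omega
    have h1 : ((b u : F[X]) * X ^ ((u : ℕ) / d * Q) * f ^ ((u : ℕ) % d * s)).natDegree ≤
        (s - 1) + (J - 1) * Q + Q * m := by
      refine natDegree_mul_le_of_le (natDegree_mul_le_of_le hb ?_) ?_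
      · rw [natDegree_X_pow]
        have : (u : ℕ) / d < J := Nat.div_lt_of_lt_mul (u.2.trans_eq hU)
        exact Nat.mul_le_mul_right _ (by omega)
      · refine (natDegree_pow_le_of_le _ hm).trans (Nat.mul_le_mul_right _ ?_)
        have : (u : ℕ) % d * s ≤ d * s :=
          Nat.mul_le_mul_right _ (Nat.mod_lt _ (by omega)).le
        omega
    refine h1.trans ?_
    have : J - 1 = s + m := by omega
    rw [this]
    have : s - 1 ≤ s := Nat.sub_le _ _
    nlinarith
  refine le_trans ?_ hGdeg
  refine (Finset.card_le_card (t := G.roots.toFinset) ?_).trans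
    ((Multiset.toFinset_card_le _).trans (card_roots' _))
  intro x hx
  rw [Finset.mem_filter] at hx
  obtain ⟨-, hx0, hxa⟩ := hx
  rw [Multiset.mem_toFinset, mem_roots hG, IsRoot.def]
  have hxq : x ^ (Q * Q) = x := by
    rw [← sq, ← hF, FiniteField.pow_card]
  have h1 : G.eval x ^ Q * f.eval x ^ (d * s) = (H b).eval x := by
    simp only [G, H, eval_finsetSum]
    have hsum : ∀ w : Fin U → F, (∑ u, w u) ^ Q = ∑ u, w u ^ Q := by
      intro w
      rw [hQ]
      exact sum_pow_char_pow _ _ _ _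
    rw [hsum, Finset.sum_mul]
    refine Finset.sum_congr rfl fun u _ => ?_
    simp only [eval_mul, eval_pow, eval_X, eval_C]
    rw [← hxa, mul_pow, mul_pow, ← pow_mul, ← pow_mul, mul_assoc ((u : ℕ) / d),
      mul_comm ((u : ℕ) / d),
      pow_mul, hxq, mul_assoc, mul_assoc (_ * _), ← pow_mul, ← pow_add, ← pow_add]
    congr 2
    have hi : (u : ℕ) % d ≤ d := (Nat.mod_lt _ (by omega)).le
    obtain ⟨t, ht⟩ := Nat.exists_eq_add_of_le hi
    generalize (u : ℕ) % d = i at *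
    subst ht
    simp only [Nat.add_sub_cancel_left]
    ring
  rw [hbH, eval_zero] at h1
  rcases mul_eq_zero.1 h1 with h | h
  · exact eq_zero_of_pow_eq_zero h
  · exact absurd (eq_zero_of_pow_eq_zero h) hx0

theorem three_le_of_mulChar_ne_one {p : ℕ} [hp : Fact p.Prime] {χ : MulChar (ZMod p) ℂ}
    (hχ : χ ≠ 1) : 3 ≤ p := by
  by_contra h
  have h2 : p = 2 := le_antisymm (by omega) hp.out.two_le
  subst h2
  refine hχ (MulChar.ext fun u => ?_)
  rw [Subsingleton.elim u 1]
  simp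

open Polynomial in
theorem norm_sum_mulChar_norm_eval_le {p : ℕ} [hp : Fact p.Prime] {χ : MulChar (ZMod p) ℂ}
    (hχ : χ ≠ 1) {F : Type*} [Field F] [Fintype F] [Algebra (ZMod p) F] {k m : ℕ}
    (hF : Fintype.card F = (p ^ k) ^ 2) {g : F[X]} (hg : g.eval 0 ≠ 0)
    (hm : (X * g).natDegree ≤ m) (hmk : m + 1 < p ^ k) :
    ‖∑ x : F, χ (Algebra.norm (ZMod p) ((X * g).eval x))‖ ≤ 2 * m * p * (p : ℝ) ^ k := by
  classical
  have hp3 := three_le_of_mulChar_ne_one hχ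
  have : CharP F p := charP_of_injective_algebraMap (algebraMap (ZMod p) F).injective p
  set Q := p ^ k with hQ
  obtain ⟨s, hs⟩ : p - 1 ∣ Q - 1 := by
    simpa using Nat.sub_dvd_pow_sub_pow p 1 k
  have hds : (p - 1) * s + 1 = Q := by omega
  set f := X * g with hf
  let N : ZMod p → Finset F := fun a => Finset.univ.filter fun x : F => f.eval x ≠ 0 ∧
    Algebra.norm (ZMod p) (f.eval x) = a
  have hN : ∀ a, (N a).card ≤ s * (Q + 1) + 2 * m * Q := by
    intro a
    refine le_trans (Finset.card_le_card fun x hx => ?_)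
      (card_filter_eval_pow_eq_le hQ hF (d := p - 1) (by omega) hds hg hm hmk
        (algebraMap (ZMod p) F a))
    simp only [N, Finset.mem_filter, Finset.mem_univ, true_and] at hx ⊢
    refine ⟨hx.1, ?_⟩
    rw [← hx.2, FiniteField.algebraMap_norm_eq_pow]
    congr 1
    rw [Nat.card_eq_fintype_card, Nat.card_eq_fintype_card, hF, ZMod.card]
    symm
    refine Nat.div_eq_of_eq_mul_left (by omega) ?_
    obtain ⟨t, ht⟩ : ∃ t, p = t + 1 := ⟨p - 1, by omega⟩
    rw [← hds, ht]
    simp only [Nat.add_sub_cancel]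
    rw [Nat.sub_eq_iff_eq_add (Nat.one_le_pow _ _ (by omega))]
    ring
  have hnz : ∀ x, f.eval x ≠ 0 → Algebra.norm (ZMod p) (f.eval x) ≠ 0 := fun x hx =>
    Algebra.norm_ne_zero_iff.2 hx
  -- decompose the sum by the value of the norm
  have hS : ∑ x : F, χ (Algebra.norm (ZMod p) (f.eval x)) =
      ∑ a ∈ Finset.univ.erase (0 : ZMod p), χ a * ((N a).card : ℂ) := by
    have h1 : ∑ x : F, χ (Algebra.norm (ZMod p) (f.eval x)) =
        ∑ x ∈ Finset.univ.filter (fun x : F => f.eval x ≠ 0),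
          χ (Algebra.norm (ZMod p) (f.eval x)) := by
      rw [Finset.sum_filter]
      refine Finset.sum_congr rfl fun x _ => ?_
      split_ifs with h
      · rfl
      · push Not at h
        rw [h, Algebra.norm_zero]
        exact χ.map_nonunit not_isUnit_zero
    rw [h1, ← Finset.sum_fiberwise_of_maps_to (t := Finset.univ.erase (0 : ZMod p))
      (g := fun x => Algebra.norm (ZMod p) (f.eval x))]
    · refine Finset.sum_congr rfl fun a _ => ?_
      rw [Finset.sum_congr rfl (g := fun _ => χ a)]
      · rw [Finset.sum_const, nsmul_eq_mul, mul_comm, Finset.filter_filter]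
      · intro x hx
        rw [(Finset.mem_filter.1 hx).2]
    · intro x hx
      simp only [Finset.mem_erase, Finset.mem_univ, and_true]
      exact hnz x (Finset.mem_filter.1 hx).2
  have hχ0 : ∑ a ∈ Finset.univ.erase (0 : ZMod p), χ a = 0 := by
    rw [← MulChar.sum_eq_zero_of_ne_one hχ, ← Finset.add_sum_erase _ _ (Finset.mem_univ 0),
      χ.map_nonunit not_isUnit_zero, zero_add]
  have hf0 : f ≠ 0 := mul_ne_zero X_ne_zero (by rintro rfl; simp at hg)
  have hcount : Q ^ 2 ≤ m + ∑ a ∈ Finset.univ.erase (0 : ZMod p), (N a).card := by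
    have h1 : (Finset.univ.filter fun x : F => f.eval x ≠ 0).card =
        ∑ a ∈ Finset.univ.erase (0 : ZMod p), (N a).card := by
      rw [Finset.card_eq_sum_card_fiberwise (t := Finset.univ.erase (0 : ZMod p))
        (f := fun x => Algebra.norm (ZMod p) (f.eval x))]
      · refine Finset.sum_congr rfl fun a _ => ?_
        rw [Finset.filter_filter]
      · intro x hx
        simp only [Finset.coe_erase, Set.mem_sdiff, Finset.coe_univ, Set.mem_univ, true_and,
          Set.mem_singleton_iff]
        exact hnz x (by simpa using hx)
    have h2 : (Finset.univ.filter fun x : F => f.eval x = 0).card ≤ m := by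
      refine le_trans ?_ hm
      refine (Finset.card_le_card (t := f.roots.toFinset) ?_).trans
        ((Multiset.toFinset_card_le _).trans (card_roots' _))
      intro x hx
      rw [Multiset.mem_toFinset, mem_roots hf0, IsRoot.def]
      simpa using hx
    have h3 := Finset.card_filter_add_card_filter_not (s := (Finset.univ : Finset F))
      (fun x => f.eval x = 0)
    rw [Finset.card_univ, hF] at h3
    rw [← h1]
    simp only [ne_eq] at h3 ⊢
    omega
  set E := s * (Q + 1) + 2 * m * Q with hE
  have hS' : ∑ x : F, χ (Algebra.norm (ZMod p) (f.eval x)) =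
      - ∑ a ∈ Finset.univ.erase (0 : ZMod p), χ a * ((E - (N a).card : ℝ) : ℂ) := by
    rw [hS]
    push_cast
    simp only [mul_sub, Finset.sum_sub_distrib, ← Finset.sum_mul, hχ0]
    simp
  rw [hS', norm_neg]
  have hb : ‖∑ a ∈ Finset.univ.erase (0 : ZMod p), χ a * ((E - (N a).card : ℝ) : ℂ)‖ ≤
      ∑ a ∈ Finset.univ.erase (0 : ZMod p), ((E : ℝ) - (N a).card) := by
    refine norm_sum_le_of_le _ fun a _ => ?_
    have hnn : (0 : ℝ) ≤ E - (N a).card := sub_nonneg.2 (by exact_mod_cast hN a)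
    rw [norm_mul, Complex.norm_real, Real.norm_of_nonneg hnn]
    exact mul_le_of_le_one_left hnn (DirichletCharacter.norm_le_one χ a)
  refine hb.trans ?_
  rw [Finset.sum_sub_distrib, Finset.sum_const, Finset.card_erase_of_mem (Finset.mem_univ _),
    Finset.card_univ, ZMod.card, nsmul_eq_mul, Nat.cast_sub (by omega), Nat.cast_one]
  have hcount' : (Q : ℝ) ^ 2 ≤ m + ∑ a ∈ Finset.univ.erase (0 : ZMod p), ((N a).card : ℝ) := by
    exact_mod_cast hcount
  have hQR : ((p : ℝ) - 1) * s + 1 = Q := by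
    rw [← hds]
    push_cast [Nat.cast_sub (by omega : 1 ≤ p)]
    ring
  have hpk : (p : ℝ) ^ k = Q := by rw [hQ]; push_cast; rfl
  rw [hpk, hE]
  push_cast
  have hQ1 : (1 : ℝ) ≤ Q := by exact_mod_cast (by omega : 1 ≤ Q)
  have hm0 : (0 : ℝ) ≤ m := Nat.cast_nonneg m
  nlinarith [mul_nonneg hm0 (sub_nonneg.2 hQ1)]

section

open Polynomial

theorem Algebra.norm_algebraMap_sub_eq {K L : Type*} [Field K] [Field L] [Algebra K L]
    [FiniteDimensional K L] (a : K) (x : L) :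
    Algebra.norm K (algebraMap K L a - x) =
      (minpoly K x).eval a ^ (Module.finrank K L / (minpoly K x).natDegree) := by
  have hx : IsIntegral K x := Algebra.IsIntegral.isIntegral x
  let M := IntermediateField.adjoin K {x}
  let pb := IntermediateField.adjoin.powerBasis hx
  let y : M := IntermediateField.AdjoinSimple.gen K x
  have hxy : algebraMap K L a - x = algebraMap M L (algebraMap K M a - y) := by
    rw [map_sub, ← IsScalarTower.algebraMap_apply]
    rfl
  have hnorm : Algebra.norm K (algebraMap K M a - y) = (minpoly K x).eval a := by
    have hy : y = pb.gen := (IntermediateField.adjoin.powerBasis_gen hx).symm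
    have hmin : minpoly K x = minpoly K pb.gen := by
      rw [← hy, IntermediateField.minpoly_gen]
    rw [hy, hmin, ← charpoly_leftMulMatrix pb, Matrix.eval_charpoly,
      Algebra.norm_eq_matrix_det pb.basis, map_sub, AlgHom.commutes, Matrix.scalar_apply,
      Matrix.algebraMap_eq_diagonal]
    rfl
  have hdeg : Module.finrank M L = Module.finrank K L / (minpoly K x).natDegree := by
    rw [← IntermediateField.adjoin.finrank hx, ← Module.finrank_mul_finrank K M L]
    exact (Nat.mul_div_cancel_left _ Module.finrank_pos).symm
  rw [hxy, ← Algebra.norm_norm (S := M), Algebra.norm_algebraMap, map_pow, hnorm, hdeg]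

section
variable {K : Type*} [Field K]

theorem finite_monic_natDegree_eq [Finite K] (n : ℕ) :
    {g : K[X] | g.Monic ∧ g.natDegree = n}.Finite := by
  have : Finite (degreeLT K (n + 1)) := Finite.of_equiv _ (degreeLTEquiv K (n + 1)).toEquiv.symm
  refine Set.Finite.subset (Set.toFinite (degreeLT K (n + 1) : Set K[X])) fun g hg => ?_
  rw [SetLike.mem_coe, mem_degreeLT]
  exact (degree_le_of_natDegree_le hg.2.le).trans_lt (by exact_mod_cast Nat.lt_succ_self n)

/-- The monic polynomials of degree `n` over a finite field. -/
noncomputable def monicsOfDegree (K : Type*) [Field K] [Finite K] (n : ℕ) : Finset K[X] :=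
  (finite_monic_natDegree_eq (K := K) n).toFinset

theorem mem_monicsOfDegree [Finite K] {n : ℕ} {g : K[X]} :
    g ∈ monicsOfDegree K n ↔ g.Monic ∧ g.natDegree = n := by
  simp [monicsOfDegree]

open Classical in
/-- The monic irreducible polynomials of degree at most `n` over a finite field. -/
noncomputable def monicIrreduciblesUpTo (K : Type*) [Field K] [Finite K] (n : ℕ) : Finset K[X] :=
  ((Finset.range (n + 1)).biUnion (monicsOfDegree K)).filter Irreducible

theorem mem_monicIrreduciblesUpTo [Finite K] {n : ℕ} {g : K[X]} :
    g ∈ monicIrreduciblesUpTo K n ↔ g.Monic ∧ Irreducible g ∧ g.natDegree ≤ n := by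
  simp only [monicIrreduciblesUpTo, Finset.mem_filter, Finset.mem_biUnion, Finset.mem_range,
    mem_monicsOfDegree]
  constructor
  · rintro ⟨⟨m, hm, h1, rfl⟩, h2⟩
    exact ⟨h1, h2, by omega⟩
  · rintro ⟨h1, h2, h3⟩
    exact ⟨⟨_, by omega, h1, rfl⟩, h2⟩

open Classical in
theorem natDegree_eq_sum_pow_dvd [Finite K] {n : ℕ} {g : K[X]} (hg : g ∈ monicsOfDegree K n) :
    n = ∑ π ∈ monicIrreduciblesUpTo K n, ∑ j ∈ Finset.Icc 1 n,
      if π ^ j ∣ g then π.natDegree else 0 := by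
  rw [mem_monicsOfDegree] at hg
  obtain ⟨hmon, rfl⟩ := hg
  have hg0 := hmon.ne_zero
  set s := UniqueFactorizationMonoid.normalizedFactors g with hs
  have hsm : ∀ π ∈ s, π.Monic := fun π hπ => by
    have h1 := UniqueFactorizationMonoid.normalize_normalized_factor π hπ
    rw [← h1]
    exact monic_normalize (UniqueFactorizationMonoid.irreducible_of_normalized_factor π hπ).ne_zero
  have hprod : s.prod = g := by
    rw [hs, UniqueFactorizationMonoid.prod_normalizedFactors_eq, hmon.normalize_eq_self]
    exact hg0
  have hcount : ∀ π ∈ monicIrreduciblesUpTo K g.natDegree,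
      ∑ j ∈ Finset.Icc 1 g.natDegree, (if π ^ j ∣ g then π.natDegree else 0) =
        s.count π * π.natDegree := by
    intro π hπ
    rw [mem_monicIrreduciblesUpTo] at hπ
    obtain ⟨hπm, hπi, hπd⟩ := hπ
    have hpos : 0 < π.natDegree := hπi.natDegree_pos
    have hiff : ∀ j, π ^ j ∣ g ↔ j ≤ s.count π := by
      intro j
      rw [pow_dvd_iff_le_emultiplicity,
        UniqueFactorizationMonoid.emultiplicity_eq_count_normalizedFactors hπi hg0,
        hπm.normalize_eq_self]
      exact Nat.cast_le
    have hle : s.count π ≤ g.natDegree := by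
      have h1 := natDegree_le_of_dvd ((hiff _).2 le_rfl) hg0
      rw [natDegree_pow] at h1
      exact (Nat.le_mul_of_pos_right _ hpos).trans h1
    simp only [hiff]
    rw [← Finset.sum_filter, Finset.sum_const, smul_eq_mul]
    congr 1
    rw [show (Finset.Icc 1 g.natDegree).filter (fun j => j ≤ s.count π) =
      Finset.Icc 1 (s.count π) by ext j; simp; omega]
    simp
  rw [Finset.sum_congr rfl hcount]
  conv_lhs => rw [← hprod, natDegree_multiset_prod_of_monic _ hsm, Finset.sum_multiset_map_count]
  simp only [smul_eq_mul]
  refine Finset.sum_subset ?_ ?_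
  · intro π hπ
    rw [Multiset.mem_toFinset] at hπ
    rw [mem_monicIrreduciblesUpTo]
    exact ⟨hsm π hπ, UniqueFactorizationMonoid.irreducible_of_normalized_factor π hπ,
      natDegree_le_of_dvd (UniqueFactorizationMonoid.dvd_of_mem_normalizedFactors hπ) hg0⟩
  · intro π _ hπ
    rw [Multiset.mem_toFinset, ← Multiset.count_eq_zero] at hπ
    rw [hπ, zero_mul]

variable [Finite K] (ψ : K[X] →* ℂ)

/-- The sum of a multiplicative function over the monic polynomials of degree `n`. -/
noncomputable def monicSum (n : ℕ) : ℂ := ∑ g ∈ monicsOfDegree K n, ψ g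

/-- The sum of a multiplicative function over prime powers of degree `n`, weighted by the
degree of the prime. -/
noncomputable def primePowerSum (n : ℕ) : ℂ :=
  ∑ π ∈ monicIrreduciblesUpTo K n, if π.natDegree ∣ n then
    (π.natDegree : ℂ) * ψ π ^ (n / π.natDegree) else 0

open Classical in
theorem sum_monicsOfDegree_pow_dvd {n j : ℕ} {π : K[X]} (hπ : π.Monic) :
    ∑ g ∈ monicsOfDegree K n, (if π ^ j ∣ g then ψ g else 0) =
      if j * π.natDegree ≤ n then ψ π ^ j * monicSum ψ (n - j * π.natDegree) else 0 := by
  rw [← Finset.sum_filter]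
  split_ifs with h
  · rw [monicSum, Finset.mul_sum]
    symm
    refine Finset.sum_bij (fun g _ => π ^ j * g) ?_ ?_ ?_ ?_
    · intro g hg
      rw [mem_monicsOfDegree] at hg
      rw [Finset.mem_filter, mem_monicsOfDegree, (hπ.pow j).natDegree_mul hg.1, hπ.natDegree_pow]
      exact ⟨⟨(hπ.pow j).mul hg.1, by omega⟩, dvd_mul_right _ _⟩
    · intro g _ g' _ hgg
      exact mul_left_cancel₀ (hπ.pow j).ne_zero hgg
    · intro g hg
      rw [Finset.mem_filter, mem_monicsOfDegree] at hg
      obtain ⟨⟨hgm, hgd⟩, g', rfl⟩ := hg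
      have hg' := (hπ.pow j).of_mul_monic_left hgm
      refine ⟨g', ?_, rfl⟩
      rw [(hπ.pow j).natDegree_mul hg', hπ.natDegree_pow] at hgd
      rw [mem_monicsOfDegree]
      exact ⟨hg', by omega⟩
    · intro g _
      rw [map_mul, map_pow]
  · rw [Finset.sum_eq_zero]
    intro g hg
    rw [Finset.mem_filter, mem_monicsOfDegree] at hg
    have := natDegree_le_of_dvd hg.2 hg.1.1.ne_zero
    rw [hπ.natDegree_pow] at this
    omega

theorem natCast_mul_monicSum (n : ℕ) : (n : ℂ) * monicSum ψ n =
    ∑ N ∈ Finset.Icc 1 n, primePowerSum ψ N * monicSum ψ (n - N) := by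
  classical
  have h1 : (n : ℂ) * monicSum ψ n = ∑ π ∈ monicIrreduciblesUpTo K n, ∑ j ∈ Finset.Icc 1 n,
      (π.natDegree : ℂ) * ∑ g ∈ monicsOfDegree K n, (if π ^ j ∣ g then ψ g else 0) := by
    simp only [Finset.mul_sum]
    rw [monicSum, Finset.mul_sum]
    conv_rhs =>
      enter [2, π]
      rw [Finset.sum_comm]
    rw [Finset.sum_comm]
    refine Finset.sum_congr rfl fun g hg => ?_
    conv_lhs => rw [natDegree_eq_sum_pow_dvd hg]
    push_cast
    rw [Finset.sum_mul]
    refine Finset.sum_congr rfl fun π _ => ?_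
    rw [Finset.sum_mul]
    refine Finset.sum_congr rfl fun j _ => ?_
    split_ifs <;> simp
  have h2 : ∀ N ∈ Finset.Icc 1 n, primePowerSum ψ N = ∑ π ∈ monicIrreduciblesUpTo K n,
      if π.natDegree ∣ N then (π.natDegree : ℂ) * ψ π ^ (N / π.natDegree) else 0 := by
    intro N hN
    rw [Finset.mem_Icc] at hN
    refine Finset.sum_subset ?_ ?_
    · intro π hπ
      rw [mem_monicIrreduciblesUpTo] at hπ ⊢
      exact ⟨hπ.1, hπ.2.1, hπ.2.2.trans hN.2⟩
    · intro π hπ hπ'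
      rw [mem_monicIrreduciblesUpTo] at hπ hπ'
      rw [if_neg]
      intro hdvd
      exact hπ' ⟨hπ.1, hπ.2.1, Nat.le_of_dvd (by omega) hdvd⟩
  have h3 : ∀ N ∈ Finset.Icc 1 n, primePowerSum ψ N * monicSum ψ (n - N) =
      ∑ π ∈ monicIrreduciblesUpTo K n, (if π.natDegree ∣ N then
        (π.natDegree : ℂ) * ψ π ^ (N / π.natDegree) else 0) * monicSum ψ (n - N) :=
    fun N hN => by rw [h2 N hN, Finset.sum_mul]
  rw [h1, Finset.sum_congr rfl h3, Finset.sum_comm (s := Finset.Icc 1 n)]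
  refine Finset.sum_congr rfl fun π hπ => ?_
  rw [mem_monicIrreduciblesUpTo] at hπ
  have hpos : 0 < π.natDegree := hπ.2.1.natDegree_pos
  simp only [sum_monicsOfDegree_pow_dvd ψ hπ.1, mul_ite, mul_zero, ite_mul, zero_mul]
  rw [← Finset.sum_filter, ← Finset.sum_filter]
  refine Finset.sum_bij (fun j _ => j * π.natDegree) ?_ ?_ ?_ ?_
  · intro j hj
    simp only [Finset.mem_filter, Finset.mem_Icc] at hj ⊢
    exact ⟨⟨Nat.mul_pos (by omega) hpos, hj.2⟩, dvd_mul_left _ _⟩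
  · intro i _ j _ h
    exact Nat.eq_of_mul_eq_mul_right hpos h
  · intro N hN
    simp only [Finset.mem_filter, Finset.mem_Icc] at hN
    obtain ⟨⟨hN1, hN2⟩, j, rfl⟩ := hN
    refine ⟨j, ?_, mul_comm _ _⟩
    simp only [Finset.mem_filter, Finset.mem_Icc]
    exact ⟨⟨Nat.pos_of_mul_pos_left hN1 , (Nat.le_mul_of_pos_left _ hpos).trans hN2⟩,
      by rwa [mul_comm]⟩
  · intro j _
    rw [Nat.mul_div_cancel _ hpos]
    ring

theorem primePowerSum_eq_sum {N : ℕ} (hN : N ≠ 0) {L : Type*} [Field L] [Fintype L]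
    [Algebra K L] (hL : Module.finrank K L = N) :
    primePowerSum ψ N = ∑ x : L, ψ (minpoly K x) ^ (N / (minpoly K x).natDegree) := by
  classical
  have hintegral : ∀ x : L, IsIntegral K x := fun x => Algebra.IsIntegral.isIntegral x
  have hdvd : ∀ x : L, (minpoly K x).natDegree ∣ N := fun x => by
    rw [← hL, ← IntermediateField.adjoin.finrank (hintegral x)]
    exact ⟨_, (Module.finrank_mul_finrank K (IntermediateField.adjoin K {x}) L).symm⟩
  rw [primePowerSum, ← Finset.sum_filter, ← Finset.sum_fiberwise_of_maps_to
    (t := (monicIrreduciblesUpTo K N).filter fun π => π.natDegree ∣ N)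
    (g := fun x : L => minpoly K x)]
  · refine Finset.sum_congr rfl fun π hπ => ?_
    rw [Finset.mem_filter, mem_monicIrreduciblesUpTo] at hπ
    obtain ⟨⟨hπm, hπi, -⟩, hπN⟩ := hπ
    rw [Finset.sum_congr rfl (g := fun _ => ψ π ^ (N / π.natDegree)), Finset.sum_const,
      nsmul_eq_mul]
    · congr 2
      have hsplit : (π.map (algebraMap K L)).Splits := by
        have h1 := (hπi.natDegree_dvd_iff_dvd_X_pow_card_pow_sub_X).1 hπN
        have hcard : Nat.card K ^ N = Nat.card L := by
          rw [← hL, ← Module.natCard_eq_pow_finrank]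
        rw [hcard] at h1
        refine Splits.of_dvd ?_ ?_ (Polynomial.map_dvd (algebraMap K L) h1)
        · simp only [Polynomial.map_sub, Polynomial.map_pow, map_X]
          rw [Nat.card_eq_fintype_card, splits_iff_card_roots, FiniteField.roots_X_pow_card_sub_X,
            FiniteField.X_pow_card_sub_X_natDegree_eq _ Fintype.one_lt_card]
          rfl
        · simp only [Polynomial.map_sub, Polynomial.map_pow, map_X]
          rw [Nat.card_eq_fintype_card]
          exact FiniteField.X_pow_card_sub_X_ne_zero _ Fintype.one_lt_card
      rw [← card_rootSet_eq_natDegree (K := L) (PerfectField.separable_of_irreducible hπi) hsplit,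
        Fintype.card_subtype]
      congr 1
      ext x
      simp only [Finset.mem_filter, Finset.mem_univ, true_and, mem_rootSet]
      constructor
      · rintro ⟨-, h⟩
        exact (minpoly.eq_of_irreducible_of_monic hπi h hπm).symm
      · rintro rfl
        exact ⟨hπm.ne_zero, minpoly.aeval _ _⟩
    · intro x hx
      rw [(Finset.mem_filter.1 hx).2]
  · intro x _
    rw [Finset.mem_filter, mem_monicIrreduciblesUpTo]
    exact ⟨⟨minpoly.monic (hintegral x), minpoly.irreducible (hintegral x),
      Nat.le_of_dvd (Nat.pos_of_ne_zero hN) (hdvd x)⟩, hdvd x⟩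

end

/-- The multiplicative function `g ↦ ∏ i, χ (g (a i)) ^ e i` on polynomials. -/
noncomputable def evalCharHom {K : Type*} [Field K] {ι : Type*} [Fintype ι] (χ : MulChar K ℂ)
    (a : ι → K) (e : ι → ℕ) : K[X] →* ℂ where
  toFun g := ∏ i, χ (g.eval (a i)) ^ e i
  map_one' := by simp
  map_mul' g h := by simp [mul_pow, Finset.prod_mul_distrib]

theorem monicSum_evalCharHom_eq_zero {K : Type*} [Field K] [Fintype K] {ι : Type*} [Fintype ι]
    {χ : MulChar K ℂ} (hχ : χ ≠ 1) {a : ι → K} {e : ι → ℕ} {i₀ : ι} (he : e i₀ = 1)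
    (ha : ∀ i, i ≠ i₀ → a i ≠ a i₀) {n : ℕ} (hn : Fintype.card ι ≤ n) :
    monicSum (evalCharHom χ a e) n = 0 := by
  classical
  set h : K[X] := ∏ i ∈ Finset.univ.erase i₀, (X - C (a i)) with hh
  have hdeg : h.natDegree < n := by
    rw [hh, natDegree_prod_of_monic _ _ fun i _ => monic_X_sub_C _]
    simp only [natDegree_X_sub_C, Finset.sum_const, smul_eq_mul, mul_one]
    rw [Finset.card_erase_of_mem (Finset.mem_univ _), Finset.card_univ]
    have : 0 < Fintype.card ι := Fintype.card_pos_iff.2 ⟨i₀⟩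
    omega
  have hu : h.eval (a i₀) ≠ 0 := by
    rw [hh, eval_prod, Finset.prod_ne_zero_iff]
    intro i hi
    rw [eval_sub, eval_X, eval_C]
    exact sub_ne_zero.2 (ha i (Finset.ne_of_mem_erase hi)).symm
  have hz : ∀ i, i ≠ i₀ → h.eval (a i) = 0 := by
    intro i hi
    rw [hh, eval_prod]
    exact Finset.prod_eq_zero (Finset.mem_erase.2 ⟨hi, Finset.mem_univ _⟩) (by simp)
  have hshift : ∀ c : K, ∑ g ∈ monicsOfDegree K n, evalCharHom χ a e (g + C c * h) =
      monicSum (evalCharHom χ a e) n := by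
    intro c
    have hdc : ∀ c : K, (C c * h).natDegree < n := fun c =>
      (natDegree_C_mul_le _ _).trans_lt hdeg
    have hmem : ∀ c : K, ∀ g ∈ monicsOfDegree K n, g + C c * h ∈ monicsOfDegree K n := by
      intro c g hg
      rw [mem_monicsOfDegree] at hg ⊢
      have hlt : (C c * h).degree < g.degree :=
        degree_lt_degree ((hdc c).trans_eq hg.2.symm)
      exact ⟨hg.1.add_of_left hlt, by
        rw [natDegree_add_eq_left_of_degree_lt hlt, hg.2]⟩
    refine Finset.sum_nbij' (fun g => g + C c * h) (fun g => g + C (-c) * h) (hmem c) (hmem (-c))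
      ?_ ?_ (fun _ _ => rfl)
    · intro g _
      simp
    · intro g _
      simp
  have hzero : ∀ g : K[X], ∑ c : K, evalCharHom χ a e (g + C c * h) = 0 := by
    intro g
    have h1 : ∀ c : K, evalCharHom χ a e (g + C c * h) =
        χ (g.eval (a i₀) + c * h.eval (a i₀)) *
          ∏ i ∈ Finset.univ.erase i₀, χ (g.eval (a i)) ^ e i := by
      intro c
      change ∏ i, _ = _
      rw [← Finset.mul_prod_erase _ _ (Finset.mem_univ i₀), he, pow_one]
      congr 1
      · simp
      · refine Finset.prod_congr rfl fun i hi => ?_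
        rw [eval_add, eval_mul, hz i (Finset.ne_of_mem_erase hi), mul_zero, add_zero]
    simp only [h1]
    rw [← Finset.sum_mul]
    have h2 : ∑ c : K, χ (g.eval (a i₀) + c * h.eval (a i₀)) = ∑ c : K, χ c :=
      Fintype.sum_equiv ((Equiv.mulRight₀ _ hu).trans (Equiv.addLeft (g.eval (a i₀)))) _ _
        fun c => rfl
    rw [h2, MulChar.sum_eq_zero_of_ne_one hχ, zero_mul]
  have hcard : (Fintype.card K : ℂ) * monicSum (evalCharHom χ a e) n = 0 := by
    calc _ = ∑ c : K, ∑ g ∈ monicsOfDegree K n, evalCharHom χ a e (g + C c * h) := by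
          simp [hshift]
      _ = 0 := by
          rw [Finset.sum_comm]
          exact Finset.sum_eq_zero fun g _ => hzero g
  exact (mul_eq_zero.1 hcard).resolve_left (by exact_mod_cast Fintype.card_ne_zero)

theorem exists_forall_norm_pow_sub_one_le {ι : Type*} [Fintype ι] {u : ι → ℂ}
    (hu : ∀ i, ‖u i‖ = 1) (M : ℕ) : ∃ k ≥ M, ∀ i, ‖u i ^ k - 1‖ < 1 / 2 := by
  have hmem : ∀ n : ℕ, (fun i => u i ^ n) ∈ Metric.closedBall (0 : ι → ℂ) 1 := by
    intro n
    rw [mem_closedBall_zero_iff, pi_norm_le_iff_of_nonneg zero_le_one]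
    intro i
    rw [norm_pow, hu, one_pow]
  obtain ⟨a, -, φ, hφ, hlim⟩ := (isCompact_closedBall (0 : ι → ℂ) 1).tendsto_subseq hmem
  obtain ⟨N, hN⟩ := Metric.cauchySeq_iff.1 hlim.cauchySeq (1 / 2) (by norm_num)
  set b := N + φ N + M
  have hb : φ N + M ≤ φ b := le_trans (by omega) (show b ≤ φ b from hφ.id_le b)
  refine ⟨φ b - φ N, by omega, fun i => ?_⟩
  have h1 := (dist_le_pi_dist _ _ i).trans_lt (hN b (by omega) N le_rfl)
  simp only [Function.comp_apply, dist_eq_norm] at h1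
  have h2 : u i ^ φ b - u i ^ φ N = u i ^ φ N * (u i ^ (φ b - φ N) - 1) := by
    rw [mul_sub, ← pow_add, mul_one, Nat.add_sub_cancel' (by omega)]
  rwa [h2, norm_mul, norm_pow, hu, one_pow, one_mul] at h1

theorem norm_le_of_norm_sum_pow_le {ι : Type*} [Fintype ι] {z : ι → ℂ} {R B : ℝ} (hR : 0 < R)
    {k₀ : ℕ} (h : ∀ k ≥ k₀, ‖∑ i, z i ^ k‖ ≤ B * R ^ k) (i : ι) : ‖z i‖ ≤ R := by
  have hu : ∀ i, ∃ u : ℂ, ‖u‖ = 1 ∧ z i = ‖z i‖ * u := by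
    intro i
    by_cases hz : z i = 0
    · exact ⟨1, by simp, by simp [hz]⟩
    · have hz' : (‖z i‖ : ℂ) ≠ 0 := by exact_mod_cast norm_ne_zero_iff.2 hz
      exact ⟨z i / ‖z i‖, by simp [hz], by field_simp⟩
  choose u hu1 hu2 using hu
  by_contra! hlt
  have hq : 1 < ‖z i‖ / R := (one_lt_div hR).2 hlt
  obtain ⟨M, hM⟩ := Filter.eventually_atTop.1
    ((tendsto_pow_atTop_atTop_of_one_lt hq).eventually_gt_atTop (2 * B))
  obtain ⟨k, hk, hk'⟩ := exists_forall_norm_pow_sub_one_le hu1 (max M k₀)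
  have h1 := hM k (le_trans (le_max_left _ _) hk)
  have h2 := h k (le_trans (le_max_right _ _) hk)
  have hre : ∀ j, ‖z j‖ ^ k * (1 / 2) ≤ (z j ^ k).re := by
    intro j
    have h3 : (z j ^ k).re = ‖z j‖ ^ k * (u j ^ k).re := by
      conv_lhs => rw [hu2 j, mul_pow, ← Complex.ofReal_pow, Complex.re_ofReal_mul]
    rw [h3]
    refine mul_le_mul_of_nonneg_left ?_ (by positivity)
    have h4 := (Complex.abs_re_le_norm _).trans_lt (hk' j)
    rw [Complex.sub_re, Complex.one_re, abs_lt] at h4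
    linarith
  have h5 : ‖z i‖ ^ k * (1 / 2) ≤ ‖∑ j, z j ^ k‖ := by
    refine le_trans ?_ (Complex.re_le_norm _)
    rw [Complex.re_sum]
    refine (hre i).trans (Finset.single_le_sum (f := fun j => (z j ^ k).re) (fun j _ => ?_)
      (Finset.mem_univ i))
    exact le_trans (by positivity) (hre j)
  rw [div_pow, lt_div_iff₀ (pow_pos hR k)] at h1
  linarith

theorem exists_eq_neg_sum_pow {A T : ℕ → ℂ} {m : ℕ} (hA0 : A 0 = 1)
    (hA : ∀ n, m < n → A n = 0)
    (hT : ∀ n : ℕ, (n : ℂ) * A n = ∑ N ∈ Finset.Icc 1 n, T N * A (n - N)) :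
    ∃ ω : Fin m → ℂ, ∀ N, N ≠ 0 → T N = - ∑ i, ω i ^ N := by
  set P : ℂ[X] := ∑ n ∈ Finset.range (m + 1), C (A n) * X ^ (m - n) with hP
  have hcoeff : ∀ n ≤ m, P.coeff (m - n) = A n := by
    intro n hn
    rw [hP, finsetSum_coeff, Finset.sum_eq_single n]
    · simp
    · intro j hj hjn
      rw [Finset.mem_range] at hj
      rw [coeff_C_mul, coeff_X_pow, if_neg (by omega), mul_zero]
    · intro h
      exact absurd (Finset.mem_range.2 (by omega)) h
  have hdegle : P.natDegree ≤ m := by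
    refine natDegree_sum_le_of_forall_le _ _ fun n _ => ?_
    exact (natDegree_C_mul_X_pow_le _ _).trans (Nat.sub_le _ _)
  have hlead : P.coeff m = 1 := by simpa [hA0] using hcoeff 0 (Nat.zero_le _)
  have hdeg : P.natDegree = m := le_antisymm hdegle (le_natDegree_of_ne_zero (by rw [hlead]; simp))
  have hmonic : P.leadingCoeff = 1 := by rw [leadingCoeff, hdeg, hlead]
  have hcard : P.roots.card = P.natDegree := (IsAlgClosed.splits P).natDegree_eq_card_roots.symm
  obtain ⟨ω, hω⟩ : ∃ ω : Fin m → ℂ, Finset.univ.val.map ω = P.roots := by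
    have hl : P.roots.toList.length = m := by rw [Multiset.length_toList, hcard, hdeg]
    refine ⟨fun i => P.roots.toList.get (i.cast hl.symm), ?_⟩
    rw [Fin.univ_val_map]
    conv_rhs => rw [← Multiset.coe_toList P.roots]
    congr 1
    refine List.ext_get (by simp [hl]) fun i h1 h2 => ?_
    simp
  have hA' : ∀ n, A n = (-1) ^ n * MvPolynomial.aeval ω (MvPolynomial.esymm (Fin m) ℂ n) := by
    intro n
    rw [MvPolynomial.aeval_esymm_eq_multiset_esymm, hω]
    rcases le_or_gt n m with hn | hn
    · rw [← hcoeff n hn, coeff_eq_esymm_roots_of_card hcard (by omega), hmonic, hdeg, one_mul,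
        Nat.sub_sub_self hn]
    · rw [hA n hn, Multiset.esymm, Multiset.powersetCard_eq_empty _ (by rw [hcard, hdeg]; exact hn)]
      simp
  have hT' : ∀ n : ℕ, (n : ℂ) * A n =
      ∑ N ∈ Finset.Icc 1 n, (- ∑ i, ω i ^ N) * A (n - N) := by
    intro n
    have h1 := congrArg (MvPolynomial.aeval ω) (MvPolynomial.mul_esymm_eq_sum (Fin m) ℂ n)
    simp only [map_mul, map_natCast, map_sum, map_pow, map_neg, map_one] at h1
    rw [hA' n, mul_left_comm, h1, ← mul_assoc, ← pow_add,
      show n + (n + 1) = 2 * n + 1 by ring, pow_succ, pow_mul, neg_one_sq, one_pow, one_mul,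
      Finset.mul_sum]
    refine Finset.sum_nbij' (fun x => x.2) (fun N => (n - N, N)) ?_ ?_ ?_ ?_ ?_
    · rintro ⟨x, y⟩ h
      simp only [Finset.mem_filter, Finset.HasAntidiagonal.mem_antidiagonal, Finset.mem_Icc] at h ⊢
      omega
    · intro N h
      simp only [Finset.mem_filter, Finset.HasAntidiagonal.mem_antidiagonal, Finset.mem_Icc] at h ⊢
      omega
    · rintro ⟨x, y⟩ h
      simp only [Finset.mem_filter, Finset.HasAntidiagonal.mem_antidiagonal] at h
      simp only [Prod.mk.injEq, and_true]
      omega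
    · intro N _
      rfl
    · rintro ⟨x, y⟩ h
      simp only [Finset.mem_filter, Finset.HasAntidiagonal.mem_antidiagonal] at h
      have : n - y = x := by omega
      simp only [this, hA' x, MvPolynomial.psum, map_sum, map_pow, MvPolynomial.aeval_X]
      ring
  refine ⟨ω, fun N => ?_⟩
  induction N using Nat.strong_induction_on with
  | _ n ih =>
  intro hn
  have h1 := (hT n).symm.trans (hT' n)
  have hmem : n ∈ Finset.Icc 1 n := Finset.mem_Icc.2 ⟨by omega, le_rfl⟩
  rw [← Finset.add_sum_erase _ _ hmem, ← Finset.add_sum_erase _ _ hmem, Nat.sub_self, hA0,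
    mul_one, mul_one] at h1
  rw [Finset.sum_congr rfl (g := fun N => (- ∑ i, ω i ^ N) * A (n - N))] at h1
  · exact add_right_cancel h1
  · intro N hN
    rw [Finset.mem_erase, Finset.mem_Icc] at hN
    rw [ih N (by omega) (by omega)]

end

open Polynomial in
theorem primePowerSum_evalCharHom {K : Type*} [Field K] [Finite K] {ι : Type*} [Fintype ι]
    (χ : MulChar K ℂ) (a : ι → K) (e : ι → ℕ) {N : ℕ} (hN : N ≠ 0) {L : Type*} [Field L]
    [Fintype L] [Algebra K L] (hL : Module.finrank K L = N) :
    primePowerSum (evalCharHom χ a e) N =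
      ∑ x : L, χ (Algebra.norm K (∏ i, (algebraMap K L (a i) - x) ^ e i)) := by
  rw [primePowerSum_eq_sum _ hN hL]
  refine Finset.sum_congr rfl fun x _ => ?_
  rw [map_prod, map_prod, evalCharHom, MonoidHom.coe_mk, OneHom.coe_mk, ← Finset.prod_pow]
  refine Finset.prod_congr rfl fun i _ => ?_
  rw [map_pow, map_pow, Algebra.norm_algebraMap_sub_eq, hL, map_pow, pow_right_comm]

open Polynomial in
theorem norm_primePowerSum_evalCharHom_le {p : ℕ} [hp : Fact p.Prime] {χ : MulChar (ZMod p) ℂ}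
    (hχ : χ ≠ 1) {ι : Type*} [Fintype ι] {a : ι → ZMod p} {e : ι → ℕ} {i₀ : ι} (he : e i₀ = 1)
    (ha : ∀ i, i ≠ i₀ → a i ≠ a i₀) :
    ∃ B : ℝ, ∃ k₀ : ℕ, ∀ k ≥ k₀,
      ‖primePowerSum (evalCharHom χ a e) (k * 2)‖ ≤ B * (p : ℝ) ^ k := by
  classical
  set s : Finset ι := Finset.univ.erase i₀
  set m : ℕ := 1 + ∑ i ∈ s, e i with hm
  refine ⟨2 * m * p, m + 2, fun k hk => ?_⟩
  have hk2 : k * 2 ≠ 0 := by omega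
  set L := GaloisField p (k * 2)
  have : Fintype L := Fintype.ofFinite L
  have hcard : Fintype.card L = (p ^ k) ^ 2 := by
    rw [← Nat.card_eq_fintype_card, GaloisField.card p _ hk2, pow_mul]
  set g : L[X] := ∏ i ∈ s, (X + C (algebraMap (ZMod p) L (a i - a i₀))) ^ e i with hg
  have hg0 : g.eval 0 ≠ 0 := by
    rw [hg, eval_prod, Finset.prod_ne_zero_iff]
    intro i hi
    rw [eval_pow, eval_add, eval_X, eval_C, zero_add]
    refine pow_ne_zero _ ?_
    rw [_root_.map_ne_zero, sub_ne_zero]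
    exact ha i (Finset.ne_of_mem_erase hi)
  have hdeg : (X * g).natDegree ≤ m := by
    refine natDegree_mul_le.trans (add_le_add natDegree_X_le ?_)
    refine (natDegree_prod_le _ _).trans (Finset.sum_le_sum fun i _ => ?_)
    refine natDegree_pow_le.trans ?_
    rw [natDegree_X_add_C, mul_one]
  have hmk : m + 1 < p ^ k := by
    have := Nat.lt_pow_self (n := k) hp.out.one_lt
    omega
  have hmain := norm_sum_mulChar_norm_eval_le hχ hcard hg0 hdeg hmk
  rw [primePowerSum_evalCharHom χ a e hk2 (GaloisField.finrank p hk2)]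
  rw [← (Equiv.subLeft (algebraMap (ZMod p) L (a i₀))).sum_comp]
  refine (le_of_eq ?_).trans hmain
  congr 1
  refine Finset.sum_congr rfl fun y _ => ?_
  rw [← Finset.mul_prod_erase _ _ (Finset.mem_univ i₀), he, pow_one, Equiv.subLeft_apply,
    sub_sub_cancel, eval_mul, eval_X, hg, eval_prod]
  congr 3
  refine Finset.prod_congr rfl fun i _ => ?_
  rw [eval_pow, eval_add, eval_X, eval_C, map_sub]
  ring

/-- **Weil's bound** for complete sums of products of multiplicative characters. -/
theorem norm_sum_prod_mulChar_add_pow_le {p : ℕ} [hp : Fact p.Prime] {χ : MulChar (ZMod p) ℂ}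
    (hχ : χ ≠ 1) {ι : Type*} [Fintype ι] {a : ι → ZMod p} {e : ι → ℕ} {i₀ : ι} (he : e i₀ = 1)
    (ha : ∀ i, i ≠ i₀ → a i ≠ a i₀) :
    ‖∑ x, ∏ i, χ (x + a i) ^ e i‖ ≤ Fintype.card ι * √p := by
  set ψ := evalCharHom χ a e
  have hA0 : monicSum ψ 0 = 1 := by
    have : monicsOfDegree (ZMod p) 0 = {1} := by
      ext g
      rw [mem_monicsOfDegree, Finset.mem_singleton]
      constructor
      · rintro ⟨h1, h2⟩
        exact h1.natDegree_eq_zero.1 h2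
      · rintro rfl
        exact ⟨Polynomial.monic_one, Polynomial.natDegree_one⟩
    rw [monicSum, this, Finset.sum_singleton, map_one]
  obtain ⟨ω, hω⟩ := exists_eq_neg_sum_pow (m := Fintype.card ι) hA0
    (fun n hn => monicSum_evalCharHom_eq_zero hχ he ha hn.le) (natCast_mul_monicSum ψ)
  obtain ⟨B, k₀, hB⟩ := norm_primePowerSum_evalCharHom_le hχ he ha
  have hp0 : (0 : ℝ) < p := by exact_mod_cast hp.out.pos
  have hω2 : ∀ i, ‖ω i‖ ≤ √p := by
    intro i
    refine Real.le_sqrt_of_sq_le ?_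
    rw [← norm_pow]
    refine norm_le_of_norm_sum_pow_le (z := fun i => ω i ^ 2) (B := B) (k₀ := max k₀ 1) hp0
      (fun k hk => ?_) i
    have h1 := hB k (le_trans (le_max_left _ _) hk)
    have h2 : 1 ≤ k := le_trans (le_max_right _ _) hk
    rw [hω _ (by omega), norm_neg] at h1
    simpa only [← pow_mul, mul_comm 2 k] using h1
  have h1 := hω 1 one_ne_zero
  rw [primePowerSum_evalCharHom χ a e one_ne_zero (Module.finrank_self (ZMod p))] at h1
  have h2 : ∑ x, ∏ i, χ (x + a i) ^ e i =
      ∑ x : ZMod p, χ (Algebra.norm (ZMod p) (∏ i, (algebraMap (ZMod p) (ZMod p) (a i) - x) ^ e i))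
      := by
    rw [← Equiv.sum_comp (Equiv.neg (ZMod p))]
    refine Finset.sum_congr rfl fun x _ => ?_
    rw [Algebra.norm_self, MonoidHom.id_apply, map_prod]
    refine Finset.prod_congr rfl fun i _ => ?_
    rw [map_pow, Equiv.neg_apply, Algebra.algebraMap_self, RingHom.id_apply, neg_add_eq_sub]
  rw [h2, h1, norm_neg]
  refine (norm_sum_le _ _).trans ?_
  refine (Finset.sum_le_sum (g := fun _ => √(p : ℝ)) fun i _ => ?_).trans (by simp)
  rw [pow_one]
  exact hω2 i

theorem norm_mulChar_le_one {p : ℕ} [Fact p.Prime] (χ : MulChar (ZMod p) ℂ) (x : ZMod p) :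
    ‖χ x‖ ≤ 1 :=
  DirichletCharacter.norm_le_one χ x

theorem mulChar_pow_sub_two_eq_inv {p : ℕ} [hp : Fact p.Prime] (hp3 : 3 ≤ p)
    (χ : MulChar (ZMod p) ℂ) (x : ZMod p) : χ x ^ (p - 2) = χ⁻¹ x := by
  rw [MulChar.inv_apply', ← map_pow]
  by_cases hx : x = 0
  · rw [hx, inv_zero, zero_pow (by omega)]
  · congr 1
    refine eq_inv_of_mul_eq_one_left ?_
    rw [← pow_succ, show p - 2 + 1 = p - 1 by omega, ZMod.pow_card_sub_one_eq_one hx]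

theorem norm_sum_prod_mulChar_add_pow_le' {p : ℕ} [hp : Fact p.Prime] {χ : MulChar (ZMod p) ℂ}
    (hχ : χ ≠ 1) {ι : Type*} [Fintype ι] {a : ι → ZMod p} {e : ι → ℕ}
    (he : ∀ i, e i = 1 ∨ e i = p - 2) {i₀ : ι} (ha : ∀ i, i ≠ i₀ → a i ≠ a i₀) :
    ‖∑ x, ∏ i, χ (x + a i) ^ e i‖ ≤ Fintype.card ι * √p := by
  have hp3 := three_le_of_mulChar_ne_one hχ
  rcases he i₀ with h | h
  · exact norm_sum_prod_mulChar_add_pow_le hχ h ha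
  · have h1 := norm_sum_prod_mulChar_add_pow_le (χ := χ⁻¹) (inv_ne_one.2 hχ) (a := a)
      (e := fun i => if e i = p - 2 then 1 else p - 2) (i₀ := i₀) (by simp [h]) ha
    refine (le_of_eq ?_).trans h1
    congr 1
    refine Finset.sum_congr rfl fun x _ => Finset.prod_congr rfl fun i _ => ?_
    split_ifs with hi
    · rw [hi, mulChar_pow_sub_two_eq_inv hp3, pow_one]
    · rw [mulChar_pow_sub_two_eq_inv hp3, inv_inv, (he i).resolve_right hi, pow_one]

theorem exists_unique_value_or_card_image_le {ι α : Type*} [Fintype ι] [DecidableEq α]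
    (f : ι → α) {r : ℕ} (hι : Fintype.card ι = 2 * r) :
    (∃ i₀, ∀ i, i ≠ i₀ → f i ≠ f i₀) ∨ (Finset.univ.image f).card ≤ r := by
  classical
  by_contra! h
  obtain ⟨h1, h2⟩ := h
  have h3 : ∑ y ∈ Finset.univ.image f, 2 ≤
      ∑ y ∈ Finset.univ.image f, (Finset.univ.filter fun i => f i = y).card := by
    refine Finset.sum_le_sum fun y hy => ?_
    obtain ⟨i, -, rfl⟩ := Finset.mem_image.1 hy
    obtain ⟨j, hj, hji⟩ := h1 i
    exact Finset.one_lt_card.2 ⟨i, by simp, j, by simp [hji], hj.symm⟩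
  rw [← Finset.card_eq_sum_card_fiberwise fun i _ =>
    Finset.mem_coe.2 (Finset.mem_image_of_mem f (Finset.mem_univ i)), Finset.card_univ, hι,
    Finset.sum_const, smul_eq_mul] at h3
  omega

theorem card_filter_card_image_le {ι α : Type*} [Fintype ι] [Nonempty ι] [DecidableEq ι]
    [DecidableEq α] (s : Finset α) (r : ℕ) :
    ((Fintype.piFinset fun _ : ι => s).filter fun f => (Finset.univ.image f).card ≤ r).card ≤
      r ^ Fintype.card ι * s.card ^ r := by
  have h : ((Fintype.piFinset fun _ : ι => s).filter fun f => (Finset.univ.image f).card ≤ r) ⊆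
      ((Finset.univ : Finset (ι → Fin r)) ×ˢ (Fintype.piFinset fun _ : Fin r => s)).image
        fun x => x.2 ∘ x.1 := by
    intro f hf
    rw [Finset.mem_filter, Fintype.mem_piFinset] at hf
    obtain ⟨hfs, hr⟩ := hf
    have hne : (Finset.univ.image f).Nonempty := Finset.univ_nonempty.image f
    obtain ⟨g⟩ : Nonempty ((Finset.univ.image f) ↪ Fin r) :=
      Function.Embedding.nonempty_of_card_le (by simpa using hr)
    have : Nonempty (Finset.univ.image f) := hne.to_subtype
    rw [Finset.mem_image]
    refine ⟨(fun i => g ⟨f i, Finset.mem_image_of_mem f (Finset.mem_univ i)⟩,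
      fun j => ((Function.invFun g j : Finset.univ.image f) : α)), ?_, ?_⟩
    · rw [Finset.mem_product, Fintype.mem_piFinset]
      refine ⟨Finset.mem_univ _, fun j => ?_⟩
      obtain ⟨i, -, hi⟩ := Finset.mem_image.1 (Function.invFun g j).2
      dsimp only
      rw [← hi]
      exact hfs i
    · funext i
      simp only [Function.comp_apply, Function.leftInverse_invFun g.injective _]
  refine (Finset.card_le_card h).trans (Finset.card_image_le.trans ?_)
  simp [Finset.card_product]

/-- The `2r`-th moment of short character sums. -/
theorem sum_norm_sum_mulChar_pow_le {p : ℕ} [hp : Fact p.Prime] {χ : MulChar (ZMod p) ℂ}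
    (hχ : χ ≠ 1) {r B : ℕ} (hr : r ≠ 0) (hB : B ≤ p) :
    ∑ y : ZMod p, ‖∑ b ∈ Finset.Icc 1 B, χ (y + (b : ZMod p))‖ ^ (2 * r) ≤
      (r : ℝ) ^ (2 * r) * (B : ℝ) ^ r * p + 2 * r * (B : ℝ) ^ (2 * r) * √p := by
  classical
  have hp3 := three_le_of_mulChar_ne_one hχ
  let ι := Fin r ⊕ Fin r
  have hι : Fintype.card ι = 2 * r := by simp [ι, two_mul]
  have : Nonempty ι := Fintype.card_pos_iff.1 (by omega)
  let e : ι → ℕ := Sum.elim (fun _ => 1) (fun _ => p - 2)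
  have he : ∀ i, e i = 1 ∨ e i = p - 2 := by
    rintro (i | i)
    · exact Or.inl rfl
    · exact Or.inr rfl
  let W : (ι → ℕ) → ℂ := fun f => ∑ y : ZMod p, ∏ i, χ (y + (f i : ZMod p)) ^ e i
  have hexp : ((∑ y : ZMod p, ‖∑ b ∈ Finset.Icc 1 B, χ (y + (b : ZMod p))‖ ^ (2 * r) : ℝ) : ℂ) =
      ∑ f ∈ Fintype.piFinset fun _ : ι => Finset.Icc 1 B, W f := by
    rw [Finset.sum_comm, Complex.ofReal_sum]
    refine Finset.sum_congr rfl fun y _ => ?_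
    rw [← Finset.prod_univ_sum (fun _ : ι => Finset.Icc 1 B)
      (fun i b => χ (y + (b : ZMod p)) ^ e i), Fintype.prod_sum_type]
    simp only [e, Sum.elim_inl, Sum.elim_inr, pow_one, Finset.prod_const, Finset.card_univ,
      Fintype.card_fin]
    rw [pow_mul, Complex.ofReal_pow, Complex.ofReal_pow, ← Complex.mul_conj', mul_pow, map_sum]
    congr 2
    refine Finset.sum_congr rfl fun b _ => ?_
    rw [mulChar_pow_sub_two_eq_inv hp3, ← MulChar.star_eq_inv, MulChar.star_apply]
    rfl
  have hW : ∀ f ∈ Fintype.piFinset fun _ : ι => Finset.Icc 1 B, ‖W f‖ ≤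
      (if (Finset.univ.image f).card ≤ r then (p : ℝ) else 0) + 2 * r * √p := by
    intro f hf
    rw [Fintype.mem_piFinset] at hf
    rcases exists_unique_value_or_card_image_le f hι with ⟨i₀, hi₀⟩ | h
    · refine le_add_of_nonneg_of_le (by split_ifs <;> positivity) ?_
      have h1 := norm_sum_prod_mulChar_add_pow_le' hχ (a := fun i => (f i : ZMod p)) he (i₀ := i₀)
        fun i hi h => hi₀ i hi ?_
      · rw [hι] at h1
        push_cast at h1
        exact h1
      · have h1 := Finset.mem_Icc.1 (hf i)
        have h2 := Finset.mem_Icc.1 (hf i₀)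
        rw [ZMod.natCast_eq_natCast_iff, Nat.modEq_iff_dvd] at h
        have h3 := Int.eq_zero_of_abs_lt_dvd h (by rw [abs_lt]; constructor <;> omega)
        omega
    · rw [if_pos h]
      refine le_add_of_le_of_nonneg ?_ (by positivity)
      refine (norm_sum_le _ _).trans ?_
      refine (Finset.sum_le_sum (g := fun _ => (1 : ℝ)) fun y _ => ?_).trans (by simp [ZMod.card])
      rw [norm_prod]
      refine Finset.prod_le_one (fun _ _ => norm_nonneg _) fun i _ => ?_
      rw [norm_pow]
      exact pow_le_one₀ (norm_nonneg _) (norm_mulChar_le_one χ _)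
  have hre : ∑ y : ZMod p, ‖∑ b ∈ Finset.Icc 1 B, χ (y + (b : ZMod p))‖ ^ (2 * r) =
      ‖∑ f ∈ Fintype.piFinset fun _ : ι => Finset.Icc 1 B, W f‖ := by
    rw [← hexp, Complex.norm_real, Real.norm_of_nonneg (by positivity)]
  rw [hre]
  refine (norm_sum_le _ _).trans ((Finset.sum_le_sum hW).trans ?_)
  rw [Finset.sum_add_distrib, ← Finset.sum_filter, Finset.sum_const, Finset.sum_const,
    nsmul_eq_mul, nsmul_eq_mul]
  have h1 := card_filter_card_image_le (ι := ι) (Finset.Icc 1 B) r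
  rw [hι, Nat.card_Icc, Nat.add_sub_cancel] at h1
  refine add_le_add ?_ (le_of_eq ?_)
  · refine mul_le_mul_of_nonneg_right ?_ (by positivity)
    exact_mod_cast h1
  · rw [Fintype.card_piFinset]
    simp only [Nat.card_Icc, Nat.add_sub_cancel, Finset.prod_const, Finset.card_univ, hι]
    push_cast
    ring

theorem sum_comp_pow_le {α β : Type*} [Fintype β] [DecidableEq β] (s : Finset α) (f : α → β)
    {T : β → ℝ} (hT : ∀ y, 0 ≤ T y) (r : ℕ) :
    (∑ x ∈ s, T (f x)) ^ (2 * (r + 1)) ≤ (s.card : ℝ) ^ (2 * r) *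
      (((s ×ˢ s).filter fun x => f x.1 = f x.2).card : ℝ) * ∑ y, T y ^ (2 * (r + 1)) := by
  have h1 := pow_sum_le_card_mul_sum_pow (s := s) (f := fun x => T (f x)) (fun x _ => hT _) r
  have h2 : ∑ x ∈ s, T (f x) ^ (r + 1) =
      ∑ y, ((s.filter fun x => f x = y).card : ℝ) * T y ^ (r + 1) := by
    rw [← Finset.sum_fiberwise s f]
    refine Finset.sum_congr rfl fun y _ => ?_
    rw [← nsmul_eq_mul, ← Finset.sum_const]
    refine Finset.sum_congr rfl fun x hx => ?_
    rw [(Finset.mem_filter.1 hx).2]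
  have h3 : (((s ×ˢ s).filter fun x => f x.1 = f x.2).card : ℝ) =
      ∑ y, ((s.filter fun x => f x = y).card : ℝ) ^ 2 := by
    rw [Finset.card_eq_sum_card_fiberwise (f := fun x => f x.1) (t := Finset.univ)
      fun x _ => Finset.mem_coe.2 (Finset.mem_univ _)]
    push_cast
    refine Finset.sum_congr rfl fun y _ => ?_
    rw [sq, ← Nat.cast_mul, ← Finset.card_product]
    congr 2
    ext ⟨x, x'⟩
    simp only [Finset.mem_filter, Finset.mem_product]
    constructor
    · rintro ⟨⟨⟨hx, hx'⟩, h⟩, rfl⟩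
      exact ⟨⟨hx, rfl⟩, hx', h.symm⟩
    · rintro ⟨⟨hx, rfl⟩, hx', h⟩
      exact ⟨⟨⟨hx, hx'⟩, h.symm⟩, rfl⟩
  have h4 := Finset.sum_mul_sq_le_sq_mul_sq Finset.univ
    (fun y => ((s.filter fun x => f x = y).card : ℝ)) fun y => T y ^ (r + 1)
  rw [← h2, ← h3] at h4
  have h5 : ∀ y, (T y ^ (r + 1)) ^ 2 = T y ^ (2 * (r + 1)) := fun y => by
    rw [← pow_mul, mul_comm]
  simp only [h5] at h4
  calc (∑ x ∈ s, T (f x)) ^ (2 * (r + 1)) = ((∑ x ∈ s, T (f x)) ^ (r + 1)) ^ 2 := by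
        rw [← pow_mul, mul_comm]
    _ ≤ ((s.card : ℝ) ^ r * ∑ x ∈ s, T (f x) ^ (r + 1)) ^ 2 :=
        pow_le_pow_left₀ (pow_nonneg (Finset.sum_nonneg fun x _ => hT _) _) h1 2
    _ = (s.card : ℝ) ^ (2 * r) * (∑ x ∈ s, T (f x) ^ (r + 1)) ^ 2 := by
        rw [mul_pow, ← pow_mul, mul_comm r]
    _ ≤ _ := by
        rw [mul_assoc]
        exact mul_le_mul_of_nonneg_left h4 (by positivity)

theorem card_Ioc_filter_modEq_le (M N v : ℕ) {q : ℕ} (hq : 0 < q) :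
    (((Finset.Ioc M (M + N)).filter fun n => n ≡ v [MOD q]).card : ℝ) ≤ N / q + 1 := by
  have h := Nat.Ioc_filter_modEq_card M (M + N) hq v
  have hq' : (0 : ℚ) < q := by exact_mod_cast hq
  have h2 : (((Finset.Ioc M (M + N)).filter fun n => n ≡ v [MOD q]).card : ℚ) ≤ N / q + 1 := by
    have h3 : (((Finset.Ioc M (M + N)).filter fun n => n ≡ v [MOD q]).card : ℚ) =
        (((((Finset.Ioc M (M + N)).filter fun n => n ≡ v [MOD q]).card : ℕ) : ℤ) : ℚ) := by
      simp
    rw [h3, h, Int.cast_max, Int.cast_zero, max_le_iff]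
    refine ⟨?_, by positivity⟩
    push_cast
    have h4 := Int.floor_le (((M : ℚ) + N - v) / q)
    have h5 := Int.lt_floor_add_one (((M : ℚ) - v) / q)
    have h6 : ((M : ℚ) + N - v) / q = (M - v) / q + N / q := by ring
    linarith
  have h7 := (Rat.cast_le (K := ℝ)).2 h2
  push_cast at h7
  exact h7

theorem card_filter_mul_eq_mul_le {p a₁ a₂ M N : ℕ} (ha₁ : 0 < a₁) (ha : a₂ ≤ a₁)
    (hp : 2 * (a₁ * N) ≤ p) :
    (((Finset.Ioc M (M + N) ×ˢ Finset.Ioc M (M + N)).filter fun n =>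
      (a₁ * n.2 : ZMod p) = a₂ * n.1).card : ℝ) ≤ N * Nat.gcd a₁ a₂ / a₁ + 1 := by
  set S := (Finset.Ioc M (M + N) ×ˢ Finset.Ioc M (M + N)).filter fun n =>
      (a₁ * n.2 : ZMod p) = a₂ * n.1 with hS
  have hg : 0 < Nat.gcd a₁ a₂ := Nat.gcd_pos_of_pos_left _ ha₁
  have hq : 0 < a₁ / Nat.gcd a₁ a₂ := Nat.div_pos (Nat.gcd_le_left _ ha₁) hg
  rcases S.eq_empty_or_nonempty with h | ⟨⟨m₁, m₂⟩, hm⟩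
  · rw [h, Finset.card_empty, Nat.cast_zero]
    positivity
  have hkey : ∀ n ∈ S, (a₁ : ℤ) * ((n.2 : ℤ) - m₂) = a₂ * ((n.1 : ℤ) - m₁) := by
    rintro ⟨n₁, n₂⟩ hn
    simp only [hS, Finset.mem_filter, Finset.mem_product, Finset.mem_Ioc] at hm hn
    have h1 : ((p : ℤ)) ∣ (a₁ : ℤ) * ((n₂ : ℤ) - m₂) - a₂ * ((n₁ : ℤ) - m₁) := by
      rw [← ZMod.intCast_zmod_eq_zero_iff_dvd]
      push_cast
      linear_combination hn.2 - hm.2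
    have h2 : |(n₂ : ℤ) - m₂| ≤ N - 1 := by rw [abs_le]; constructor <;> omega
    have h3 : |(n₁ : ℤ) - m₁| ≤ N - 1 := by rw [abs_le]; constructor <;> omega
    refine sub_eq_zero.1 (Int.eq_zero_of_abs_lt_dvd h1 ((abs_sub _ _).trans_lt ?_))
    rw [abs_mul, abs_mul, Nat.abs_cast, Nat.abs_cast]
    have h4 : (a₁ : ℤ) * |(n₂ : ℤ) - m₂| ≤ a₁ * (N - 1) := by gcongr
    have h5 : (a₂ : ℤ) * |(n₁ : ℤ) - m₁| ≤ a₁ * (N - 1) := by gcongr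
    have h6 : (2 : ℤ) * (a₁ * N) ≤ p := by exact_mod_cast hp
    have h7 : (0 : ℤ) < a₁ := by exact_mod_cast ha₁
    linarith
  have h1 : S.card ≤ ((Finset.Ioc M (M + N)).filter fun n =>
      n ≡ m₁ [MOD a₁ / Nat.gcd a₁ a₂]).card := by
    refine Finset.card_le_card_of_injOn Prod.fst ?_ ?_
    · rintro ⟨n₁, n₂⟩ hn
      have h2 := hkey _ hn
      simp only [hS, Finset.coe_filter, Set.mem_ofPred_eq, Finset.mem_product] at hn ⊢
      refine ⟨hn.1.1, ?_⟩
      refine (Nat.modEq_iff_dvd.2 ?_).symm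
      have h3 : IsCoprime ((a₁ / Nat.gcd a₁ a₂ : ℕ) : ℤ) ((a₂ / Nat.gcd a₁ a₂ : ℕ) : ℤ) :=
        Nat.isCoprime_iff_coprime.2 (Nat.coprime_div_gcd_div_gcd hg)
      refine h3.dvd_of_dvd_mul_left ⟨(n₂ : ℤ) - m₂, ?_⟩
      obtain ⟨c₁, hc₁⟩ := Nat.gcd_dvd_left a₁ a₂
      obtain ⟨c₂, hc₂⟩ := Nat.gcd_dvd_right a₁ a₂
      have h4 : a₁ / Nat.gcd a₁ a₂ = c₁ := Nat.div_eq_of_eq_mul_right hg hc₁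
      have h5 : a₂ / Nat.gcd a₁ a₂ = c₂ := Nat.div_eq_of_eq_mul_right hg hc₂
      rw [h4, h5]
      have h6 : ((Nat.gcd a₁ a₂ : ℕ) : ℤ) ≠ 0 := by exact_mod_cast hg.ne'
      have h7 : (a₁ : ℤ) = Nat.gcd a₁ a₂ * c₁ := by exact_mod_cast hc₁
      have h8 : (a₂ : ℤ) = Nat.gcd a₁ a₂ * c₂ := by exact_mod_cast hc₂
      refine mul_left_cancel₀ h6 ?_
      rw [← mul_assoc, ← mul_assoc, ← h7, ← h8]
      exact h2.symm
    · rintro ⟨n₁, n₂⟩ hn ⟨n₁', n₂'⟩ hn' h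
      have h2 := hkey _ hn
      have h3 := hkey _ hn'
      dsimp only at h h2 h3
      subst h
      have h4 : (a₁ : ℤ) ≠ 0 := by exact_mod_cast ha₁.ne'
      have h5 := mul_left_cancel₀ h4 (h2.trans h3.symm)
      simp only [Prod.mk.injEq, true_and]
      omega
  refine (Nat.cast_le.2 h1).trans ((card_Ioc_filter_modEq_le M N m₁ hq).trans (le_of_eq ?_))
  rw [Nat.cast_div (Nat.gcd_dvd_left _ _) (by exact_mod_cast hg.ne'), div_div_eq_mul_div]

theorem sum_Ioc_gcd_le {a A : ℕ} (ha : a ∈ Finset.Ioc 0 A) :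
    ∑ b ∈ Finset.Ioc 0 a, Nat.gcd a b ≤ a * ((Finset.Ioc 0 A).filter (· ∣ a)).card := by
  rw [Finset.mem_Ioc] at ha
  calc ∑ b ∈ Finset.Ioc 0 a, Nat.gcd a b
      ≤ ∑ b ∈ Finset.Ioc 0 a, ∑ d ∈ (Finset.Ioc 0 A).filter (· ∣ a), if d ∣ b then d else 0 := by
        refine Finset.sum_le_sum fun b _ => ?_
        have hmem : Nat.gcd a b ∈ (Finset.Ioc 0 A).filter (· ∣ a) := by
          rw [Finset.mem_filter, Finset.mem_Ioc]
          exact ⟨⟨Nat.gcd_pos_of_pos_left _ ha.1, (Nat.gcd_le_left _ ha.1).trans ha.2⟩,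
            Nat.gcd_dvd_left _ _⟩
        refine le_trans ?_ (Finset.single_le_sum (f := fun d => if d ∣ b then d else 0)
          (fun _ _ => Nat.zero_le _) hmem)
        simp only [Nat.gcd_dvd_right, if_true, le_refl]
    _ = ∑ d ∈ (Finset.Ioc 0 A).filter (· ∣ a), a := by
        rw [Finset.sum_comm]
        refine Finset.sum_congr rfl fun d hd => ?_
        rw [← Finset.sum_filter, Finset.sum_const, Nat.Ioc_filter_dvd_card_eq_div, smul_eq_mul,
          Nat.div_mul_cancel (Finset.mem_filter.1 hd).2]
    _ = _ := by rw [Finset.sum_const, smul_eq_mul, mul_comm]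

theorem sum_Ioc_card_filter_dvd_le (A : ℕ) :
    ((∑ a ∈ Finset.Ioc 0 A, ((Finset.Ioc 0 A).filter (· ∣ a)).card : ℕ) : ℝ) ≤
      A * (1 + Real.log A) := by
  have h1 : ∑ a ∈ Finset.Ioc 0 A, ((Finset.Ioc 0 A).filter (· ∣ a)).card =
      ∑ d ∈ Finset.Ioc 0 A, A / d := by
    simp only [Finset.card_filter]
    rw [Finset.sum_comm]
    refine Finset.sum_congr rfl fun d _ => ?_
    rw [← Finset.card_filter, Nat.Ioc_filter_dvd_card_eq_div]
  have h2 := harmonic_le_one_add_log A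
  rw [harmonic_eq_sum_Icc] at h2
  push_cast at h2
  rw [h1, Nat.cast_sum]
  refine le_trans ?_ (mul_le_mul_of_nonneg_left h2 (Nat.cast_nonneg A))
  rw [Finset.mul_sum]
  refine Finset.sum_le_sum fun d _ => ?_
  exact Nat.cast_div_le.trans (le_of_eq (div_eq_mul_inv _ _))

theorem card_filter_inv_mul_eq_le {p : ℕ} [hp : Fact p.Prime] {A M N : ℕ}
    (hAN : 2 * (A * N) ≤ p) (hN : 0 < N) :
    ((((Finset.Ioc 0 A ×ˢ Finset.Ioc M (M + N)) ×ˢ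
      (Finset.Ioc 0 A ×ˢ Finset.Ioc M (M + N))).filter fun x =>
        (x.1.1 : ZMod p)⁻¹ * x.1.2 = (x.2.1 : ZMod p)⁻¹ * x.2.2).card : ℝ) ≤
      2 * (A * A + N * (A * (1 + Real.log A))) := by
  classical
  set I := Finset.Ioc 0 A
  set J := Finset.Ioc M (M + N)
  let F : ℕ → ℕ → ℕ := fun a₁ a₂ =>
    ((J ×ˢ J).filter fun n => (a₁ * n.2 : ZMod p) = a₂ * n.1).card
  let G : ℕ → ℕ → ℝ := fun a₁ a₂ => if a₂ ≤ a₁ then N * Nat.gcd a₁ a₂ / a₁ + 1 else 0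
  have hne : ∀ a ∈ I, (a : ZMod p) ≠ 0 := by
    intro a ha h
    rw [Finset.mem_Ioc] at ha
    rw [ZMod.natCast_eq_zero_iff] at h
    have := Nat.le_of_dvd ha.1 h
    nlinarith
  have hcard : (((I ×ˢ J) ×ˢ (I ×ˢ J)).filter fun x =>
        (x.1.1 : ZMod p)⁻¹ * x.1.2 = (x.2.1 : ZMod p)⁻¹ * x.2.2).card =
      ∑ a₁ ∈ I, ∑ a₂ ∈ I, F a₁ a₂ := by
    simp only [F, Finset.card_filter, Finset.sum_product]
    refine Finset.sum_congr rfl fun a₁ ha₁ => ?_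
    rw [Finset.sum_comm]
    refine Finset.sum_congr rfl fun a₂ ha₂ => ?_
    refine Finset.sum_congr rfl fun n₁ _ => ?_
    refine Finset.sum_congr rfl fun n₂ _ => ?_
    congr 1
    have h1 := hne a₁ ha₁
    have h2 := hne a₂ ha₂
    rw [eq_iff_iff, inv_mul_eq_iff_eq_mul₀ h1, mul_left_comm, eq_inv_mul_iff_mul_eq₀ h2]
    exact eq_comm
  have hFG : ∀ a₁ ∈ I, ∀ a₂ ∈ I, a₂ ≤ a₁ → (F a₁ a₂ : ℝ) ≤ G a₁ a₂ := by
    intro a₁ ha₁ a₂ ha₂ h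
    rw [Finset.mem_Ioc] at ha₁
    simp only [G, if_pos h]
    exact card_filter_mul_eq_mul_le ha₁.1 h (le_trans (by gcongr; exact ha₁.2) hAN)
  have hFsymm : ∀ a₁ a₂, F a₁ a₂ = F a₂ a₁ := by
    intro a₁ a₂
    refine Finset.card_bij' (fun n _ => n.swap) (fun n _ => n.swap) ?_ ?_ ?_ ?_
    · rintro ⟨n₁, n₂⟩ h
      simp only [Finset.mem_filter, Finset.mem_product, Prod.swap] at h ⊢
      exact ⟨h.1.symm, h.2.symm⟩
    · rintro ⟨n₁, n₂⟩ h
      simp only [Finset.mem_filter, Finset.mem_product, Prod.swap] at h ⊢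
      exact ⟨h.1.symm, h.2.symm⟩
    · intro n _
      rfl
    · intro n _
      rfl
  have hG0 : ∀ a₁ a₂, 0 ≤ G a₁ a₂ := by
    intro a₁ a₂
    simp only [G]
    split_ifs <;> positivity
  have hGsum : ∀ a ∈ I, ∑ b ∈ I, G a b ≤ A + N * (I.filter (· ∣ a)).card := by
    intro a ha
    have h1 := sum_Ioc_gcd_le ha
    have ha' := Finset.mem_Ioc.1 ha
    have h2 : I.filter (· ≤ a) = Finset.Ioc 0 a := by
      ext b
      simp only [I, Finset.mem_filter, Finset.mem_Ioc]
      omega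
    have ha0 : (0 : ℝ) < a := by exact_mod_cast ha'.1
    simp only [G]
    rw [← Finset.sum_filter, h2, Finset.sum_add_distrib, Finset.sum_const, Nat.card_Ioc, add_comm,
      nsmul_eq_mul, mul_one, Nat.sub_zero, ← Finset.sum_div, ← Finset.mul_sum]
    refine add_le_add (by exact_mod_cast ha'.2) ?_
    rw [div_le_iff₀ ha0, mul_assoc]
    refine mul_le_mul_of_nonneg_left ?_ (by positivity)
    rw [mul_comm _ (a : ℝ)]
    exact_mod_cast h1
  rw [hcard]
  push_cast
  calc ∑ a₁ ∈ I, ∑ a₂ ∈ I, (F a₁ a₂ : ℝ)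
      ≤ ∑ a₁ ∈ I, ∑ a₂ ∈ I, (G a₁ a₂ + G a₂ a₁) := by
        refine Finset.sum_le_sum fun a₁ ha₁ => Finset.sum_le_sum fun a₂ ha₂ => ?_
        rcases le_total a₂ a₁ with h | h
        · exact (hFG a₁ ha₁ a₂ ha₂ h).trans (le_add_of_nonneg_right (hG0 _ _))
        · rw [hFsymm]
          exact (hFG a₂ ha₂ a₁ ha₁ h).trans (le_add_of_nonneg_left (hG0 _ _))
    _ = 2 * ∑ a₁ ∈ I, ∑ a₂ ∈ I, G a₁ a₂ := by
        simp only [Finset.sum_add_distrib]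
        rw [Finset.sum_comm (f := fun a₁ a₂ => G a₂ a₁), two_mul]
    _ ≤ 2 * ∑ a ∈ I, ((A : ℝ) + N * (I.filter (· ∣ a)).card) := by
        refine mul_le_mul_of_nonneg_left (Finset.sum_le_sum hGsum) zero_le_two
    _ ≤ _ := by
        refine mul_le_mul_of_nonneg_left ?_ zero_le_two
        have h1 := sum_Ioc_card_filter_dvd_le A
        push_cast at h1
        rw [Finset.sum_add_distrib, ← Finset.mul_sum, Finset.sum_const, Nat.card_Ioc,
          nsmul_eq_mul, Nat.sub_zero]
        gcongr

theorem sum_Ioc_eq_shift {E : Type*} [AddCommGroup E] (f : ℕ → E) (M N h : ℕ) :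
    ∑ n ∈ Finset.Ioc M (M + N), f n = ∑ n ∈ Finset.Ioc (M + h) (M + h + N), f n +
      (∑ n ∈ Finset.Ioc M (M + h), f n - ∑ n ∈ Finset.Ioc (M + N) (M + N + h), f n) := by
  have h1 := Finset.sum_Ioc_consecutive f (Nat.le_add_right M N) (Nat.le_add_right (M + N) h)
  have h2 := Finset.sum_Ioc_consecutive f (Nat.le_add_right M h) (Nat.le_add_right (M + h) N)
  rw [show M + h + N = M + N + h by ring] at h2 ⊢
  rw [eq_sub_of_add_eq (h1.trans h2.symm)]
  abel

theorem card_mul_norm_le_norm_sum_add {E : Type*} [NormedAddCommGroup E] [NormedSpace ℝ E]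
    {ι : Type*} (s : Finset ι) (x : E) (y : ι → E) {D : ℝ} (h : ∀ i ∈ s, ‖x - y i‖ ≤ D) :
    s.card * ‖x‖ ≤ ‖∑ i ∈ s, y i‖ + s.card * D := by
  have h1 : (s.card : ℝ) • x = ∑ i ∈ s, y i + ∑ i ∈ s, (x - y i) := by
    rw [Finset.sum_sub_distrib, Finset.sum_const, ← Nat.cast_smul_eq_nsmul ℝ]
    abel
  have h2 : ‖(s.card : ℝ) • x‖ = s.card * ‖x‖ := by
    rw [norm_smul, Real.norm_of_nonneg (Nat.cast_nonneg _)]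
  rw [← h2, h1]
  refine (norm_add_le _ _).trans (add_le_add le_rfl ((norm_sum_le_of_le _ h).trans ?_))
  rw [Finset.sum_const, nsmul_eq_mul]

theorem norm_sum_shifts_pow_le {p : ℕ} [hp : Fact p.Prime] {χ : MulChar (ZMod p) ℂ}
    (hχ : χ ≠ 1) {r A B M N : ℕ} (hB : B ≤ p) (hN : 0 < N) (hAN : 2 * (A * N) ≤ p) :
    ‖∑ x ∈ Finset.Ioc 0 A ×ˢ Finset.Icc 1 B,
      ∑ n ∈ Finset.Ioc (M + x.1 * x.2) (M + x.1 * x.2 + N), χ (n : ZMod p)‖ ^ (2 * (r + 1)) ≤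
      ((A : ℝ) * N) ^ (2 * r) * (2 * (A * A + N * (A * (1 + Real.log A)))) *
        (((r + 1 : ℕ) : ℝ) ^ (2 * (r + 1)) * (B : ℝ) ^ (r + 1) * p +
          2 * ((r + 1 : ℕ) : ℝ) * (B : ℝ) ^ (2 * (r + 1)) * √p) := by
  let s := Finset.Ioc 0 A ×ˢ Finset.Ioc M (M + N)
  let f : ℕ × ℕ → ZMod p := fun x => (x.1 : ZMod p)⁻¹ * x.2
  let T : ZMod p → ℝ := fun y => ‖∑ b ∈ Finset.Icc 1 B, χ (y + (b : ZMod p))‖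
  have hne : ∀ a ∈ Finset.Ioc 0 A, (a : ZMod p) ≠ 0 := by
    intro a ha h
    rw [Finset.mem_Ioc] at ha
    rw [ZMod.natCast_eq_zero_iff] at h
    have := Nat.le_of_dvd ha.1 h
    nlinarith
  have h1 : ‖∑ x ∈ Finset.Ioc 0 A ×ˢ Finset.Icc 1 B,
      ∑ n ∈ Finset.Ioc (M + x.1 * x.2) (M + x.1 * x.2 + N), χ (n : ZMod p)‖ ≤
      ∑ x ∈ s, T (f x) := by
    have h2 : ∀ x : ℕ × ℕ, ∑ n ∈ Finset.Ioc (M + x.1 * x.2) (M + x.1 * x.2 + N),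
        χ (n : ZMod p) = ∑ n ∈ Finset.Ioc M (M + N), χ ((n + x.1 * x.2 : ℕ) : ZMod p) := by
      intro x
      rw [show M + x.1 * x.2 + N = (M + N) + x.1 * x.2 by ring,
        ← Finset.map_add_right_Ioc, Finset.sum_map]
      rfl
    simp only [h2]
    rw [Finset.sum_product, Finset.sum_product]
    refine (norm_sum_le _ _).trans (Finset.sum_le_sum fun a ha => ?_)
    rw [Finset.sum_comm]
    refine (norm_sum_le _ _).trans (Finset.sum_le_sum fun n _ => ?_)
    have h3 : ∑ b ∈ Finset.Icc 1 B, χ ((n + a * b : ℕ) : ZMod p) =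
        χ a * ∑ b ∈ Finset.Icc 1 B, χ (f (a, n) + (b : ZMod p)) := by
      rw [Finset.mul_sum]
      refine Finset.sum_congr rfl fun b _ => ?_
      rw [← map_mul, mul_add, mul_inv_cancel_left₀ (hne a ha)]
      push_cast
      rfl
    rw [h3, norm_mul]
    exact mul_le_of_le_one_left (norm_nonneg _) (norm_mulChar_le_one χ _)
  have h2 := sum_comp_pow_le s f (T := T) (fun y => norm_nonneg _) r
  have h3 := card_filter_inv_mul_eq_le (p := p) (M := M) hAN hN
  have h4 := sum_norm_sum_mulChar_pow_le hχ (Nat.succ_ne_zero r) hB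
  refine (pow_le_pow_left₀ (norm_nonneg _) h1 _).trans (h2.trans ?_)
  have h5 : (s.card : ℝ) = A * N := by
    simp [s, Finset.card_product]
  rw [h5]
  have h6 : 0 ≤ ∑ y, T y ^ (2 * (r + 1)) :=
    Finset.sum_nonneg fun y _ => pow_nonneg (norm_nonneg _) _
  refine mul_le_mul (mul_le_mul_of_nonneg_left h3 (by positivity)) h4 h6 ?_
  have h7 := Real.log_natCast_nonneg A
  positivity

/-- Burgess' inequality, raised to the power `2 (r + 1)`. -/
theorem norm_sum_mulChar_pow_le {p : ℕ} [hp : Fact p.Prime] {χ : MulChar (ZMod p) ℂ}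
    (hχ : χ ≠ 1) {r : ℕ} (hr : 1 ≤ r) {P : ℝ} (hP0 : 0 ≤ P) (hP : P ^ (2 * (r + 1)) = p) (M N : ℕ)
    (hN : (N : ℝ) ^ 2 ≤ P ^ (2 * r + 3)) :
    ‖∑ n ∈ Finset.Ioc M (M + N), χ (n : ZMod p)‖ ^ (2 * (r + 1)) ≤
      192 * (((r + 1 : ℕ) : ℝ) ^ (2 * (r + 1)) + 2 * ((r + 1 : ℕ) : ℝ)) * 16 ^ (r + 1) *
        (N : ℝ) ^ (2 * r) * P ^ (r + 2) * Real.log p := by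
  have hp3 := three_le_of_mulChar_ne_one hχ
  set c : ℝ := ((r + 1 : ℕ) : ℝ) ^ (2 * (r + 1)) + 2 * ((r + 1 : ℕ) : ℝ) with hc
  set K : ℝ := 192 * c * 16 ^ (r + 1) with hK
  set L := Real.log p with hL
  have hc1 : 2 ≤ c := by
    have : (1 : ℝ) ≤ ((r + 1 : ℕ) : ℝ) := by exact_mod_cast Nat.succ_pos r
    have h2 : (0 : ℝ) ≤ ((r + 1 : ℕ) : ℝ) ^ (2 * (r + 1)) := by positivity
    linarith
  have hK256 : 256 ≤ K := by
    have : (1 : ℝ) ≤ 16 ^ (r + 1) := one_le_pow₀ (by norm_num)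
    rw [hK]
    nlinarith
  have hL1 : 1 ≤ L := by
    rw [hL, Real.le_log_iff_exp_le (by exact_mod_cast hp.out.pos)]
    have h3 : (3 : ℝ) ≤ p := by exact_mod_cast hp3
    linarith [Real.exp_one_lt_d9]
  have hP1 : 1 ≤ P := by
    by_contra! h
    have h1 := pow_lt_one₀ hP0 h (show 2 * (r + 1) ≠ 0 by omega)
    rw [hP] at h1
    have h3 : (3 : ℝ) ≤ p := by exact_mod_cast hp3
    linarith
  induction N using Nat.strong_induction_on generalizing M with
  | _ N ih =>
  rcases Nat.eq_zero_or_pos N with rfl | hN0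
  · rw [Nat.add_zero, Finset.Ioc_self, Finset.sum_empty, norm_zero, zero_pow (by omega)]
    positivity
  have hN0' : (0 : ℝ) < N := by exact_mod_cast hN0
  by_cases htriv : (N : ℝ) ^ 2 ≤ K * P ^ (r + 2) * L
  · have h1 : ‖∑ n ∈ Finset.Ioc M (M + N), χ (n : ZMod p)‖ ≤ N := by
      refine (norm_sum_le_of_le _ fun n _ => norm_mulChar_le_one χ _).trans ?_
      simp
    calc _ ≤ (N : ℝ) ^ (2 * (r + 1)) := pow_le_pow_left₀ (norm_nonneg _) h1 _
      _ = (N : ℝ) ^ (2 * r) * (N : ℝ) ^ 2 := by rw [← pow_add]; ring_nf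
      _ ≤ (N : ℝ) ^ (2 * r) * (K * P ^ (r + 2) * L) := by gcongr
      _ = _ := by ring
  push Not at htriv
  set B := ⌊P⌋₊ with hB
  have hBP : (B : ℝ) ≤ P := Nat.floor_le hP0
  have hB1 : 1 ≤ B := Nat.one_le_floor_iff _ |>.2 hP1
  have hB1' : (1 : ℝ) ≤ B := by exact_mod_cast hB1
  have hPB : P ≤ 2 * B := by
    have := (Nat.lt_floor_add_one P).le
    linarith
  have hN16 : 16 * P ≤ N := by
    refine le_of_lt (lt_of_pow_lt_pow_left₀ 2 hN0'.le (lt_of_le_of_lt ?_ htriv))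
    have h1 : P ^ 2 ≤ P ^ (r + 2) := pow_le_pow_right₀ hP1 (by omega)
    calc (16 * P) ^ 2 = 256 * P ^ 2 * 1 := by ring
      _ ≤ K * P ^ (r + 2) * L := by gcongr
  set A := N / (16 * B) with hA
  have hAB : 16 * (A * B) ≤ N := by
    have := Nat.div_mul_le_self N (16 * B)
    rw [← hA] at this
    linarith
  have hAB' : 16 * ((A : ℝ) * B) ≤ N := by exact_mod_cast hAB
  have hA1 : 1 ≤ A := by
    rw [hA, Nat.one_le_div_iff (by omega)]
    have : (16 : ℝ) * B ≤ N := by linarith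
    exact_mod_cast this
  have hA1' : (1 : ℝ) ≤ A := by exact_mod_cast hA1
  have hNAB : (N : ℝ) ≤ 32 * (A * B) := by
    have h1 : N < 16 * B * (A + 1) := Nat.lt_mul_div_succ N (by omega)
    have h2 : N ≤ 32 * (A * B) := by nlinarith
    exact_mod_cast h2
  have hAN : (A : ℝ) ≤ N := by nlinarith
  have h2AN : 2 * (A * N) ≤ p := by
    have h1 : 8 * (A * P) ≤ N := by nlinarith
    have h2 : (2 * (A * N) : ℝ) ≤ p := by
      have h3 : P * (2 * (A * N)) ≤ P * p := by
        rw [← hP, ← pow_succ']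
        have : 2 * (r + 1) + 1 = 2 * r + 3 := by ring
        rw [this]
        refine le_trans ?_ hN
        nlinarith
      exact le_of_mul_le_mul_left h3 (by linarith)
    exact_mod_cast h2
  have hBp : B ≤ p := by
    have h1 : P ≤ p := by
      rw [← hP]
      exact le_self_pow₀ hP1 (by omega)
    exact_mod_cast hBP.trans h1
  have hlogA : Real.log A ≤ L := by
    refine Real.log_le_log (by linarith) ?_
    have : A ≤ p := by nlinarith
    exact_mod_cast this
  have hE0 : 0 ≤ K * (N : ℝ) ^ (2 * r) * P ^ (r + 2) * L := by positivity
  obtain ⟨E, hE, hE2⟩ : ∃ E : ℝ, 0 ≤ E ∧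
      E ^ (2 * (r + 1)) = K * (N : ℝ) ^ (2 * r) * P ^ (r + 2) * L :=
    ⟨_, Real.rpow_nonneg hE0 _, Real.rpow_inv_natCast_pow hE0 (by omega)⟩
  rw [← hE2]
  refine pow_le_pow_left₀ (norm_nonneg _) ?_ _
  have hbd : ∀ M' h : ℕ, 16 * h ≤ N →
      ‖∑ n ∈ Finset.Ioc M' (M' + h), χ (n : ZMod p)‖ ≤ E / 4 := by
    intro M' h hh
    have hh' : 16 * (h : ℝ) ≤ N := by exact_mod_cast hh
    have h1 := ih h (by omega) M' (le_trans (by gcongr; linarith) hN)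
    refine le_of_pow_le_pow_left₀ (show 2 * (r + 1) ≠ 0 by omega) (by positivity) (h1.trans ?_)
    rw [div_pow, hE2, le_div_iff₀ (by positivity)]
    have h2 : (h : ℝ) ^ (2 * r) * 4 ^ (2 * (r + 1)) ≤ (N : ℝ) ^ (2 * r) := by
      calc (h : ℝ) ^ (2 * r) * 4 ^ (2 * (r + 1)) ≤ (h : ℝ) ^ (2 * r) * 4 ^ (2 * (2 * r)) := by
            gcongr
            · norm_num
            · omega
        _ = (16 * h) ^ (2 * r) := by rw [mul_pow, pow_mul 4 2]; norm_num; ring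
        _ ≤ _ := by gcongr
    calc K * (h : ℝ) ^ (2 * r) * P ^ (r + 2) * L * 4 ^ (2 * (r + 1)) =
          K * ((h : ℝ) ^ (2 * r) * 4 ^ (2 * (r + 1))) * P ^ (r + 2) * L := by ring
      _ ≤ _ := by gcongr
  have hmain := norm_sum_shifts_pow_le hχ (r := r) (M := M) hBp hN0 h2AN
  set W := ‖∑ x ∈ Finset.Ioc 0 A ×ˢ Finset.Icc 1 B,
      ∑ n ∈ Finset.Ioc (M + x.1 * x.2) (M + x.1 * x.2 + N), χ (n : ZMod p)‖ with hW
  have hcard : ((Finset.Ioc 0 A ×ˢ Finset.Icc 1 B).card : ℝ) = A * B := by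
    simp [Finset.card_product]
  have havg := card_mul_norm_le_norm_sum_add (Finset.Ioc 0 A ×ˢ Finset.Icc 1 B)
    (∑ n ∈ Finset.Ioc M (M + N), χ (n : ZMod p))
    (fun x => ∑ n ∈ Finset.Ioc (M + x.1 * x.2) (M + x.1 * x.2 + N), χ (n : ZMod p)) (D := E / 2)
    (by
      rintro ⟨a, b⟩ hab
      rw [Finset.mem_product, Finset.mem_Ioc, Finset.mem_Icc] at hab
      have h1 : 16 * (a * b) ≤ N := le_trans (by gcongr <;> tauto) hAB
      rw [sum_Ioc_eq_shift _ M N (a * b), add_sub_cancel_left]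
      have h2 := hbd M _ h1
      have h3 := hbd (M + N) _ h1
      refine (norm_sub_le _ _).trans ?_
      linarith)
  rw [hcard, ← hW] at havg
  have hWE : W ≤ A * B * (E / 2) := by
    refine le_of_pow_le_pow_left₀ (show 2 * (r + 1) ≠ 0 by omega) (by positivity)
      (hmain.trans ?_)
    have hsqrt : √(p : ℝ) = P ^ (r + 1) := by
      rw [← hP, mul_comm, pow_mul, Real.sqrt_sq (by positivity)]
    have h1 : 2 * ((A : ℝ) * A + N * (A * (1 + Real.log A))) ≤ 6 * (N * A * L) := by
      have h2 : (A : ℝ) * A ≤ N * A * L := by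
        calc (A : ℝ) * A = A * A * 1 := by ring
          _ ≤ N * A * L := by gcongr
      have h3 : (N : ℝ) * (A * (1 + Real.log A)) ≤ N * (A * (L + L)) := by gcongr
      linarith
    have h2 : ((r + 1 : ℕ) : ℝ) ^ (2 * (r + 1)) * (B : ℝ) ^ (r + 1) * p +
          2 * ((r + 1 : ℕ) : ℝ) * (B : ℝ) ^ (2 * (r + 1)) * √p ≤ c * P ^ (3 * (r + 1)) := by
      rw [hsqrt, ← hP]
      calc _ ≤ ((r + 1 : ℕ) : ℝ) ^ (2 * (r + 1)) * P ^ (r + 1) * P ^ (2 * (r + 1)) +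
          2 * ((r + 1 : ℕ) : ℝ) * P ^ (2 * (r + 1)) * P ^ (r + 1) := by gcongr
        _ = _ := by rw [hc]; ring
    have h3 : P ^ (2 * r + 1) ≤ 2 ^ (2 * r + 1) * (B : ℝ) ^ (2 * r + 1) := by
      rw [← mul_pow]
      gcongr
    have hlogA0 := Real.log_natCast_nonneg A
    calc _ ≤ ((A : ℝ) * N) ^ (2 * r) * (6 * (N * A * L)) * (c * P ^ (3 * (r + 1))) := by
          gcongr
      _ = (A : ℝ) ^ (2 * r + 1) * N ^ (2 * r) * N * (6 * c) * L * P ^ (r + 2) *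
          P ^ (2 * r + 1) := by
          ring
      _ ≤ (A : ℝ) ^ (2 * r + 1) * N ^ (2 * r) * (32 * (A * B)) * (6 * c) * L * P ^ (r + 2) *
          (2 ^ (2 * r + 1) * (B : ℝ) ^ (2 * r + 1)) := by
          gcongr
      _ = (A : ℝ) ^ (2 * r + 2) * (B : ℝ) ^ (2 * r + 2) * (192 * c * 2 ^ (2 * r + 1) *
          N ^ (2 * r) * P ^ (r + 2) * L) := by ring
      _ ≤ (A : ℝ) ^ (2 * r + 2) * (B : ℝ) ^ (2 * r + 2) * (192 * c * 4 ^ (r + 1) *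
          N ^ (2 * r) * P ^ (r + 2) * L) := by
          have : (2 : ℝ) ^ (2 * r + 1) ≤ 4 ^ (r + 1) := by
            rw [show (4 : ℝ) = 2 ^ 2 by norm_num, ← pow_mul]
            exact pow_le_pow_right₀ (by norm_num) (by omega)
          gcongr
      _ = _ := by
          have h16 : (16 : ℝ) ^ (r + 1) = 4 ^ (r + 1) * 2 ^ (2 * (r + 1)) := by
            rw [pow_mul, ← mul_pow]
            norm_num
          rw [mul_pow, div_pow, hE2, hK, h16]
          field_simp
          ring
  have hAB0 : (0 : ℝ) < A * B := by positivity
  have : (A : ℝ) * B * ‖∑ n ∈ Finset.Ioc M (M + N), χ (n : ZMod p)‖ ≤ A * B * E := by linarith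
  exact le_of_mul_le_mul_left this hAB0

theorem norm_gaussSum_stdAddChar {p : ℕ} [hp : Fact p.Prime] {χ : MulChar (ZMod p) ℂ}
    (hχ : χ ≠ 1) : ‖gaussSum χ (ZMod.stdAddChar (N := p))‖ = √p := by
  have h1 := gaussSum_mul_gaussSum_eq_card hχ (ZMod.isPrimitive_stdAddChar p)
  have h2 : gaussSum χ⁻¹ (ZMod.stdAddChar (N := p))⁻¹ =
      (starRingEnd ℂ) (gaussSum χ (ZMod.stdAddChar (N := p))) := by
    rw [gaussSum, gaussSum, map_sum]
    refine Finset.sum_congr rfl fun x _ => ?_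
    rw [map_mul, ← MulChar.star_eq_inv, MulChar.star_apply, AddChar.inv_apply,
      AddChar.map_neg_eq_conj]
    rfl
  rw [h2, Complex.mul_conj', ZMod.card] at h1
  rw [eq_comm, Real.sqrt_eq_iff_eq_sq (by positivity) (norm_nonneg _)]
  exact_mod_cast h1.symm

theorem mulChar_mul_gaussSum_inv {p : ℕ} [hp : Fact p.Prime] {χ : MulChar (ZMod p) ℂ}
    (hχ : χ ≠ 1) (ψ : AddChar (ZMod p) ℂ) (n : ZMod p) :
    χ n * gaussSum χ⁻¹ ψ = ∑ a, χ⁻¹ a * ψ (a * n) := by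
  by_cases hn : n = 0
  · subst hn
    simp only [MulChar.map_zero, zero_mul, mul_zero, AddChar.map_zero_eq_one, mul_one]
    exact (MulChar.sum_eq_zero_of_ne_one (inv_ne_one.2 hχ)).symm
  · have h := gaussSum_mulShift χ⁻¹ ψ (Units.mk0 n hn)
    rw [← h, Units.val_mk0, ← mul_assoc, ← MulChar.mul_apply, mul_inv_cancel,
      MulChar.one_apply (isUnit_iff_ne_zero.2 hn), one_mul, gaussSum]
    refine Finset.sum_congr rfl fun a _ => ?_
    rw [AddChar.mulShift_apply, mul_comm n]

theorem norm_sum_Ioc_pow_le {z : ℂ} (hz : ‖z‖ = 1) (M N : ℕ) :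
    ‖∑ n ∈ Finset.Ioc M (M + N), z ^ n‖ * ‖z - 1‖ ≤ 2 := by
  have h : (∑ n ∈ Finset.Ioc M (M + N), z ^ n) * (z - 1) = z ^ (M + N + 1) - z ^ (M + 1) := by
    have h1 : Finset.Ioc M (M + N) = Finset.Ico (M + 1) (M + N + 1) := by
      ext
      simp only [Finset.mem_Ioc, Finset.mem_Ico]
      omega
    rw [h1, geom_sum_Ico_mul _ (by omega)]
  rw [← norm_mul, h]
  refine (norm_sub_le _ _).trans (le_of_eq ?_)
  rw [norm_pow, norm_pow, hz, one_pow, one_pow]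
  norm_num

theorem le_norm_exp_sub_one {p a : ℕ} (ha : 0 < a) (hap : a < p) :
    4 ≤ ‖Complex.exp (2 * Real.pi * Complex.I * a / p) - 1‖ *
      (p * ((a : ℝ)⁻¹ + ((p - a : ℕ) : ℝ)⁻¹)) := by
  have ha0 : (0 : ℝ) < a := by exact_mod_cast ha
  have hap' : (a : ℝ) < p := by exact_mod_cast hap
  have hp0 : (0 : ℝ) < p := ha0.trans hap'
  rw [Nat.cast_sub hap.le]
  have hsub : (0 : ℝ) < p - a := sub_pos.2 hap'
  have h1 : (2 * Real.pi * Complex.I * a / p : ℂ) =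
      Complex.I * ((2 * (Real.pi * a / p) : ℝ) : ℂ) := by
    push_cast
    ring
  rw [h1, Complex.norm_exp_I_mul_ofReal_sub_one, mul_div_cancel_left₀ _ two_ne_zero]
  have hpi := Real.pi_pos
  have hkey : ∀ b : ℝ, 0 < b → b ≤ p / 2 → 2 * b / p ≤ Real.sin (Real.pi * b / p) := by
    intro b hb hbp
    have h2 := Real.mul_le_sin (x := Real.pi * b / p) (by positivity) (by
      rw [div_le_div_iff₀ hp0 two_pos]
      nlinarith)
    refine le_trans (le_of_eq ?_) h2
    field_simp
  have hfin : ∀ b : ℝ, 0 < b → b ≤ p / 2 → b⁻¹ ≤ (a : ℝ)⁻¹ + ((p : ℝ) - a)⁻¹ →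
      Real.sin (Real.pi * a / p) = Real.sin (Real.pi * b / p) →
      4 ≤ ‖2 * Real.sin (Real.pi * a / p)‖ * (p * ((a : ℝ)⁻¹ + ((p : ℝ) - a)⁻¹)) := by
    intro b hb hbp hinv hsin
    have h2 := hkey b hb hbp
    have h3 : 2 * (2 * b / p) ≤ ‖2 * Real.sin (Real.pi * a / p)‖ := by
      rw [hsin]
      exact (mul_le_mul_of_nonneg_left h2 zero_le_two).trans (Real.le_norm_self _)
    calc (4 : ℝ) = 2 * (2 * b / p) * (p * b⁻¹) := by field_simp; norm_num
      _ ≤ _ := by gcongr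
  rcases le_total (a : ℝ) (p / 2) with h | h
  · exact hfin a ha0 h (le_add_of_nonneg_right (by positivity)) rfl
  · refine hfin (p - a) hsub (by linarith) (le_add_of_nonneg_left (by positivity)) ?_
    rw [← Real.sin_pi_sub]
    congr 1
    field_simp

theorem norm_sum_stdAddChar_le {p : ℕ} [hp : Fact p.Prime] {a : ℕ} (ha : 0 < a) (hap : a < p)
    (M N : ℕ) :
    ‖∑ n ∈ Finset.Ioc M (M + N), ZMod.stdAddChar ((a : ZMod p) * (n : ZMod p))‖ ≤
      p / 2 * ((a : ℝ)⁻¹ + ((p - a : ℕ) : ℝ)⁻¹) := by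
  have h1 : ∀ n : ℕ, ZMod.stdAddChar ((a : ZMod p) * (n : ZMod p)) =
      ZMod.stdAddChar (a : ZMod p) ^ n := by
    intro n
    rw [← AddChar.map_nsmul_eq_pow, nsmul_eq_mul, mul_comm]
  simp only [h1]
  have h2 : ZMod.stdAddChar (a : ZMod p) = Complex.exp (2 * Real.pi * Complex.I * a / p) := by
    have := ZMod.stdAddChar_coe (N := p) (a : ℤ)
    push_cast at this
    exact this
  have h3 := le_norm_exp_sub_one ha hap
  rw [← h2] at h3
  have h4 := norm_sum_Ioc_pow_le (AddChar.norm_apply (ZMod.stdAddChar (N := p)) a) M N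
  set S := ‖∑ n ∈ Finset.Ioc M (M + N), ZMod.stdAddChar (a : ZMod p) ^ n‖
  set D := ‖ZMod.stdAddChar (a : ZMod p) - 1‖
  set Q := (p : ℝ) * ((a : ℝ)⁻¹ + ((p - a : ℕ) : ℝ)⁻¹) with hQ
  have hQ0 : 0 ≤ Q := by positivity
  have h5 : S * 4 ≤ 2 * Q := by
    calc S * 4 ≤ S * (D * Q) := by gcongr
      _ = S * D * Q := by ring
      _ ≤ 2 * Q := by gcongr
  rw [div_mul_eq_mul_div, ← hQ]
  linarith

/-- The **Pólya–Vinogradov inequality** for prime moduli. -/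
theorem norm_sum_mulChar_le_sqrt_mul_log {p : ℕ} [hp : Fact p.Prime] {χ : MulChar (ZMod p) ℂ}
    (hχ : χ ≠ 1) (M N : ℕ) :
    ‖∑ n ∈ Finset.Ioc M (M + N), χ (n : ZMod p)‖ ≤ √p * (1 + Real.log p) := by
  have hp0 : (0 : ℝ) < p := by exact_mod_cast hp.out.pos
  have h1 : (∑ n ∈ Finset.Ioc M (M + N), χ (n : ZMod p)) *
      gaussSum χ⁻¹ (ZMod.stdAddChar (N := p)) =
      ∑ a ∈ Finset.Ico 1 p, χ⁻¹ (a : ZMod p) *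
        ∑ n ∈ Finset.Ioc M (M + N), ZMod.stdAddChar ((a : ZMod p) * (n : ZMod p)) := by
    simp only [Finset.sum_mul, mulChar_mul_gaussSum_inv hχ, Finset.mul_sum]
    rw [Finset.sum_comm]
    have h2 : ∀ F : ZMod p → ℂ, F 0 = 0 → ∑ a, F a = ∑ a ∈ Finset.Ico 1 p, F (a : ZMod p) := by
      intro F hF
      symm
      refine Finset.sum_bij_ne_zero (fun a _ _ => (a : ZMod p)) (fun _ _ _ => Finset.mem_univ _)
        ?_ ?_ fun _ _ _ => rfl
      · intro a ha _ b hb _ h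
        rw [Finset.mem_Ico] at ha hb
        rw [ZMod.natCast_eq_natCast_iff', Nat.mod_eq_of_lt ha.2, Nat.mod_eq_of_lt hb.2] at h
        exact h
      · intro x _ hx
        have hx0 : x ≠ 0 := by
          rintro rfl
          exact hx hF
        refine ⟨x.val, Finset.mem_Ico.2 ⟨?_, ZMod.val_lt x⟩, ?_, ZMod.natCast_zmod_val x⟩
        · exact Nat.one_le_iff_ne_zero.2 ((ZMod.val_ne_zero x).2 hx0)
        · rwa [ZMod.natCast_zmod_val]
    refine h2 (fun a => ∑ n ∈ Finset.Ioc M (M + N), χ⁻¹ a * ZMod.stdAddChar (a * (n : ZMod p))) ?_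
    simp only [MulChar.map_zero, zero_mul, Finset.sum_const_zero]
  have h2 := congrArg norm h1
  rw [norm_mul, norm_gaussSum_stdAddChar (inv_ne_one.2 hχ)] at h2
  have h3 : ‖∑ n ∈ Finset.Ioc M (M + N), χ (n : ZMod p)‖ * √p ≤
      ∑ a ∈ Finset.Ico 1 p, p / 2 * ((a : ℝ)⁻¹ + ((p - a : ℕ) : ℝ)⁻¹) := by
    rw [h2]
    refine norm_sum_le_of_le _ fun a ha => ?_
    rw [Finset.mem_Ico] at ha
    rw [norm_mul]
    exact (mul_le_of_le_one_left (norm_nonneg _) (norm_mulChar_le_one _ _)).trans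
      (norm_sum_stdAddChar_le ha.1 ha.2 M N)
  have h4 : ∑ a ∈ Finset.Ico 1 p, (a : ℝ)⁻¹ ≤ 1 + Real.log p := by
    have h5 := harmonic_le_one_add_log p
    rw [harmonic_eq_sum_Icc] at h5
    push_cast at h5
    refine le_trans (Finset.sum_le_sum_of_subset_of_nonneg (fun a ha => ?_) fun a _ _ => ?_) h5
    · rw [Finset.mem_Ico] at ha
      exact Finset.mem_Icc.2 ⟨ha.1, ha.2.le⟩
    · positivity
  have h5 : ∑ a ∈ Finset.Ico 1 p, (((p - a : ℕ) : ℝ))⁻¹ = ∑ a ∈ Finset.Ico 1 p, (a : ℝ)⁻¹ := by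
    have := Finset.sum_Ico_reflect (fun a : ℕ => (a : ℝ)⁻¹) 1 (Nat.le_succ p)
    rw [this]
    simp
  rw [← Finset.mul_sum, Finset.sum_add_distrib, h5] at h3
  have hs : 0 < √(p : ℝ) := Real.sqrt_pos.2 hp0
  refine le_of_mul_le_mul_right ?_ hs
  calc _ ≤ (p : ℝ) * (1 + Real.log p) := by
        refine h3.trans ?_
        rw [← two_mul, ← mul_assoc, div_mul_cancel₀ _ two_ne_zero]
        exact mul_le_mul_of_nonneg_left h4 hp0.le
    _ = _ := by
        nth_rewrite 1 [← Real.mul_self_sqrt hp0.le]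
        ring

theorem one_le_log_of_mulChar_ne_one {p : ℕ} [hp : Fact p.Prime] {χ : MulChar (ZMod p) ℂ}
    (hχ : χ ≠ 1) : 1 ≤ Real.log p := by
  rw [Real.le_log_iff_exp_le (by exact_mod_cast hp.out.pos)]
  have h3 : (3 : ℝ) ≤ p := by exact_mod_cast three_le_of_mulChar_ne_one hχ
  linarith [Real.exp_one_lt_d9]

/-- **Burgess' inequality** for prime moduli and sums of moderate length. -/
theorem exists_norm_sum_mulChar_le_of_le_rpow {r : ℕ} (hr : 2 ≤ r) :
    ∃ C : ℝ, 0 < C ∧ ∀ (p : ℕ) [Fact p.Prime], ∀ χ : MulChar (ZMod p) ℂ, χ ≠ 1 → ∀ M N : ℕ,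
      (N : ℝ) ≤ (p : ℝ) ^ (1 / 2 + (r : ℝ)⁻¹ / 4) →
      ‖∑ n ∈ Finset.Ioc M (M + N), χ (n : ZMod p)‖ ≤ C * (N : ℝ) ^ (1 - (r : ℝ)⁻¹) *
        (p : ℝ) ^ (((r : ℝ)⁻¹ + (r : ℝ)⁻¹ ^ 2) / 4) * Real.log p ^ ((r : ℝ)⁻¹ / 2) := by
  obtain ⟨t, rfl⟩ : ∃ t, r = t + 1 := ⟨r - 1, by omega⟩
  set R : ℝ := ((t + 1 : ℕ) : ℝ) with hR
  have hR0 : 0 < R := by rw [hR]; positivity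
  have hRt : R = t + 1 := by rw [hR]; push_cast; ring
  set K : ℝ := 192 * (R ^ (2 * (t + 1)) + 2 * R) * 16 ^ (t + 1) with hK
  have hK0 : 0 < K := by positivity
  have hpow : ∀ {y : ℝ} (s : ℝ), 0 ≤ y → (y ^ s) ^ (2 * (t + 1)) = y ^ (s * (2 * R)) := by
    intro y s hy
    rw [← Real.rpow_natCast, ← Real.rpow_mul hy]
    push_cast
    rw [← hRt]
  refine ⟨K ^ (2 * R)⁻¹, by positivity, fun p hp χ hχ M N hN => ?_⟩
  have hp0 : (0 : ℝ) ≤ p := Nat.cast_nonneg p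
  have hL := one_le_log_of_mulChar_ne_one hχ
  have hP : ((p : ℝ) ^ (2 * R)⁻¹) ^ (2 * (t + 1)) = p := by
    rw [hpow _ hp0, inv_mul_cancel₀ (by positivity), Real.rpow_one]
  have h := norm_sum_mulChar_pow_le hχ (show 1 ≤ t by omega) (P := (p : ℝ) ^ (2 * R)⁻¹)
    (by positivity) hP M N (by
      refine (pow_le_pow_left₀ (Nat.cast_nonneg N) hN 2).trans (le_of_eq ?_)
      rw [← Real.rpow_natCast, ← Real.rpow_natCast, ← Real.rpow_mul hp0, ← Real.rpow_mul hp0]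
      congr 1
      push_cast
      rw [hRt]
      field_simp
      ring)
  refine le_of_pow_le_pow_left₀ (show 2 * (t + 1) ≠ 0 by omega) (by positivity)
    (h.trans (le_of_eq ?_))
  rw [mul_pow, mul_pow, mul_pow, hpow _ hK0.le, hpow _ (Nat.cast_nonneg N), hpow _ hp0,
    hpow _ (by linarith), inv_mul_cancel₀ (by positivity), Real.rpow_one]
  congr 1
  · congr 1
    · congr 1
      rw [← Real.rpow_natCast]
      congr 1
      push_cast
      rw [hRt]
      field_simp
      ring
    · rw [← Real.rpow_natCast, ← Real.rpow_mul hp0]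
      congr 1
      push_cast
      rw [hRt]
      field_simp
      ring
  · rw [show R⁻¹ / 2 * (2 * R) = 1 by field_simp, Real.rpow_one]

/-- **Burgess' inequality** for prime moduli. -/
theorem exists_norm_sum_mulChar_le {r : ℕ} (hr : 3 ≤ r) :
    ∃ C : ℝ, 0 < C ∧ ∀ (p : ℕ) [Fact p.Prime], ∀ χ : MulChar (ZMod p) ℂ, χ ≠ 1 → ∀ M N : ℕ,
      ‖∑ n ∈ Finset.Ioc M (M + N), χ (n : ZMod p)‖ ≤ C * (N : ℝ) ^ (1 - (r : ℝ)⁻¹) *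
        (p : ℝ) ^ (((r : ℝ)⁻¹ + (r : ℝ)⁻¹ ^ 2) / 4) * Real.log p ^ ((r : ℝ)⁻¹ / 2) := by
  obtain ⟨C₁, hC₁, h₁⟩ := exists_norm_sum_mulChar_le_of_le_rpow (show 2 ≤ r by omega)
  obtain ⟨C₂, hC₂, h₂⟩ := exists_norm_sum_mulChar_le_of_le_rpow (le_refl 2)
  refine ⟨C₁ + 48 * C₂ + 72, by positivity, fun p hp χ hχ M N => ?_⟩
  have hp1 : (1 : ℝ) ≤ p := by exact_mod_cast hp.out.one_lt.le
  have hp0 : (0 : ℝ) < p := by linarith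
  have hL := one_le_log_of_mulChar_ne_one hχ
  have hu0 : 0 < (r : ℝ)⁻¹ := by positivity
  have hu3 : (r : ℝ)⁻¹ ≤ 1 / 3 := by
    rw [one_div]
    exact inv_anti₀ (by norm_num) (by exact_mod_cast hr)
  set u : ℝ := (r : ℝ)⁻¹
  set L := Real.log p with hLdef
  have hLu : 1 ≤ L ^ (u / 2) := Real.one_le_rpow hL (by positivity)
  have hlog : ∀ k : ℝ, 0 < k → L ≤ k * (p : ℝ) ^ (1 / k) := by
    intro k hk
    have := Real.log_le_rpow_div hp0.le (show 0 < 1 / k by positivity)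
    rwa [div_div_eq_mul_div, div_one, mul_comm] at this
  set G := (N : ℝ) ^ (1 - u) * (p : ℝ) ^ ((u + u ^ 2) / 4) * L ^ (u / 2) with hG
  have hG0 : 0 ≤ G := by positivity
  suffices h : ‖∑ n ∈ Finset.Ioc M (M + N), χ (n : ZMod p)‖ ≤ C₁ * G ∨
      ‖∑ n ∈ Finset.Ioc M (M + N), χ (n : ZMod p)‖ ≤ 48 * C₂ * G ∨
      ‖∑ n ∈ Finset.Ioc M (M + N), χ (n : ZMod p)‖ ≤ 72 * G by
    have h1 : 0 ≤ C₁ * G := by positivity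
    have h2 : 0 ≤ C₂ * G := by positivity
    rw [mul_assoc, mul_assoc, ← mul_assoc ((N : ℝ) ^ (1 - u)), ← hG]
    rcases h with h | h | h <;> nlinarith
  rcases le_or_gt (N : ℝ) ((p : ℝ) ^ (1 / 2 + u / 4)) with hN | hN
  · left
    refine (h₁ p χ hχ M N hN).trans (le_of_eq ?_)
    rw [hG]
    ring
  have hN0 : (0 : ℝ) < N := lt_of_le_of_lt (by positivity) hN
  right
  rcases le_or_gt (N : ℝ) ((p : ℝ) ^ (5 / 8 : ℝ)) with hN' | hN'
  · left
    have h := h₂ p χ hχ M N (hN'.trans (le_of_eq (by norm_num)))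
    norm_num at h
    refine h.trans ?_
    have h3 : L ^ (1 / 4 : ℝ) ≤ 48 * (p : ℝ) ^ (1 / 48 : ℝ) :=
      (Real.rpow_le_self_of_one_le hL (by norm_num)).trans (hlog 48 (by norm_num))
    have h4 : (p : ℝ) ^ (1 / 48 : ℝ) * (p : ℝ) ^ (3 / 16 : ℝ) ≤
        (N : ℝ) ^ (1 / 2 - u) * (p : ℝ) ^ ((u + u ^ 2) / 4) := by
      calc (p : ℝ) ^ (1 / 48 : ℝ) * (p : ℝ) ^ (3 / 16 : ℝ)
          ≤ ((p : ℝ) ^ (1 / 2 + u / 4)) ^ (1 / 2 - u) * (p : ℝ) ^ ((u + u ^ 2) / 4) := by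
            rw [← Real.rpow_mul hp0.le, ← Real.rpow_add hp0, ← Real.rpow_add hp0]
            refine Real.rpow_le_rpow_of_exponent_le hp1 ?_
            nlinarith
        _ ≤ _ := by
            gcongr
            linarith
    have h5 : (N : ℝ) ^ (1 - u) = (N : ℝ) ^ (1 / 2 : ℝ) * (N : ℝ) ^ (1 / 2 - u) := by
      rw [← Real.rpow_add hN0]
      congr 1
      ring
    calc _ ≤ C₂ * (N : ℝ) ^ (1 / 2 : ℝ) * (p : ℝ) ^ (3 / 16 : ℝ) *
          (48 * (p : ℝ) ^ (1 / 48 : ℝ)) := by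
          gcongr
      _ = 48 * C₂ * ((N : ℝ) ^ (1 / 2 : ℝ) * ((p : ℝ) ^ (1 / 48 : ℝ) * (p : ℝ) ^ (3 / 16 : ℝ)) * 1)
          := by ring
      _ ≤ 48 * C₂ * ((N : ℝ) ^ (1 / 2 : ℝ) *
          ((N : ℝ) ^ (1 / 2 - u) * (p : ℝ) ^ ((u + u ^ 2) / 4)) * L ^ (u / 2)) := by gcongr
      _ = 48 * C₂ * G := by rw [hG, h5]; ring
  · right
    refine (norm_sum_mulChar_le_sqrt_mul_log hχ M N).trans ?_
    have h3 : 1 + L ≤ 72 * (p : ℝ) ^ (1 / 36 : ℝ) := by linarith [hlog 36 (by norm_num)]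
    have h4 : √(p : ℝ) * (p : ℝ) ^ (1 / 36 : ℝ) ≤
        (N : ℝ) ^ (1 - u) * (p : ℝ) ^ ((u + u ^ 2) / 4) := by
      calc √(p : ℝ) * (p : ℝ) ^ (1 / 36 : ℝ)
          ≤ ((p : ℝ) ^ (5 / 8 : ℝ)) ^ (1 - u) * (p : ℝ) ^ ((u + u ^ 2) / 4) := by
            rw [Real.sqrt_eq_rpow, ← Real.rpow_mul hp0.le, ← Real.rpow_add hp0,
              ← Real.rpow_add hp0]
            refine Real.rpow_le_rpow_of_exponent_le hp1 ?_
            nlinarith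
        _ ≤ _ := by
            gcongr
            linarith
    calc √(p : ℝ) * (1 + L) ≤ √(p : ℝ) * (72 * (p : ℝ) ^ (1 / 36 : ℝ)) := by gcongr
      _ = 72 * (√(p : ℝ) * (p : ℝ) ^ (1 / 36 : ℝ) * 1) := by ring
      _ ≤ 72 * ((N : ℝ) ^ (1 - u) * (p : ℝ) ^ ((u + u ^ 2) / 4) * L ^ (u / 2)) := by gcongr
      _ = 72 * G := by rw [hG]

theorem sq_dvd_sq_mul_iff_of_squarefree {a b d : ℕ} (ha : Squarefree a) (hb : b ≠ 0) :
    d ^ 2 ∣ b ^ 2 * a ↔ d ∣ b := by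
  refine ⟨fun h => ?_, fun h => (pow_dvd_pow_of_dvd h 2).mul_right a⟩
  have hg : 0 < Nat.gcd d b := Nat.gcd_pos_of_pos_right d (Nat.pos_of_ne_zero hb)
  obtain ⟨d', b', hcop, hd, hb'⟩ := Nat.exists_coprime d b
  have h1 : d' ^ 2 ∣ b' ^ 2 * a := by
    refine Nat.dvd_of_mul_dvd_mul_right (pow_pos hg 2) ?_
    rwa [← mul_pow, ← hd, mul_right_comm, ← mul_pow, ← hb']
  have h2 : d' ^ 2 ∣ a := (Nat.Coprime.pow 2 2 hcop).dvd_of_dvd_mul_left h1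
  have h3 : d' = 1 := Nat.isUnit_iff.mp (ha d' (by rwa [← sq]))
  rw [hd, h3, one_mul]
  exact Nat.gcd_dvd_right d b

theorem sum_moebius_sq_dvd {m X : ℕ} (hm : m ≠ 0) (hmX : m ≤ X) :
    ∑ d ∈ Finset.Ioc 0 X with d ^ 2 ∣ m, ArithmeticFunction.moebius d =
      ArithmeticFunction.moebius m ^ 2 := by
  obtain ⟨a, b, rfl, ha⟩ := Nat.sq_mul_squarefree m
  have hb : b ≠ 0 := by rintro rfl; simp at hm
  have ha0 : a ≠ 0 := ha.ne_zero
  have hbX : b ≤ X := by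
    refine le_trans ?_ hmX
    calc b ≤ b ^ 2 := Nat.le_self_pow two_ne_zero b
      _ ≤ b ^ 2 * a := Nat.le_mul_of_pos_right _ (Nat.pos_of_ne_zero ha0)
  have hset : (Finset.Ioc 0 X).filter (fun d => d ^ 2 ∣ b ^ 2 * a) = b.divisors := by
    ext d
    simp only [Finset.mem_filter, Finset.mem_Ioc, Nat.mem_divisors,
      sq_dvd_sq_mul_iff_of_squarefree ha hb]
    exact ⟨fun h => ⟨h.2, hb⟩, fun h => ⟨⟨Nat.pos_of_dvd_of_pos h.1 (Nat.pos_of_ne_zero hb),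
      (Nat.le_of_dvd (Nat.pos_of_ne_zero hb) h.1).trans hbX⟩, h.1⟩⟩
  rw [hset, ← ArithmeticFunction.coe_mul_zeta_apply, ArithmeticFunction.moebius_mul_coe_zeta,
    ArithmeticFunction.one_apply, ArithmeticFunction.moebius_sq]
  refine if_congr ⟨?_, ?_⟩ rfl rfl
  · rintro rfl
    simpa using ha
  · intro h
    exact Nat.isUnit_iff.mp (h b (by rw [← sq]; exact dvd_mul_right _ _))

theorem sum_Ioc_filter_dvd {M : Type*} [AddCommMonoid M] {q : ℕ} (hq : 0 < q) (X : ℕ)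
    (f : ℕ → M) :
    ∑ m ∈ Finset.Ioc 0 X with q ∣ m, f m = ∑ k ∈ Finset.Ioc 0 (X / q), f (q * k) := by
  refine Finset.sum_nbij' (fun m => m / q) (fun k => q * k) ?_ ?_ ?_ ?_ ?_
  · intro m hm
    simp only [Finset.mem_filter, Finset.mem_Ioc] at hm ⊢
    exact ⟨Nat.div_pos (Nat.le_of_dvd hm.1.1 hm.2) hq, Nat.div_le_div_right hm.1.2⟩
  · intro k hk
    simp only [Finset.mem_filter, Finset.mem_Ioc] at hk ⊢
    exact ⟨⟨Nat.mul_pos hq hk.1, (Nat.mul_le_mul_left q hk.2).trans (Nat.mul_div_le X q)⟩,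
      dvd_mul_right _ _⟩
  · intro m hm
    exact Nat.mul_div_cancel' (Finset.mem_filter.mp hm).2
  · intro k _
    exact Nat.mul_div_cancel_left k hq
  · intro m hm
    rw [Nat.mul_div_cancel' (Finset.mem_filter.mp hm).2]

theorem sum_moebius_sq_mul_mulChar {n : ℕ} (χ : MulChar (ZMod n) ℂ) (X : ℕ) :
    ∑ m ∈ Finset.Ioc 0 X, ((ArithmeticFunction.moebius m : ℤ) ^ 2 : ℂ) * χ (m : ZMod n) =
      ∑ d ∈ Finset.Ioc 0 X, (ArithmeticFunction.moebius d : ℂ) * χ ((d : ZMod n) ^ 2) *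
        ∑ k ∈ Finset.Ioc 0 (X / d ^ 2), χ (k : ZMod n) := by
  calc _ = ∑ m ∈ Finset.Ioc 0 X, ∑ d ∈ Finset.Ioc 0 X,
        if d ^ 2 ∣ m then (ArithmeticFunction.moebius d : ℂ) * χ (m : ZMod n) else 0 := by
        refine Finset.sum_congr rfl fun m hm => ?_
        rw [Finset.mem_Ioc] at hm
        rw [← Finset.sum_filter, ← Finset.sum_mul]
        congr 1
        exact_mod_cast (sum_moebius_sq_dvd hm.1.ne' hm.2).symm
    _ = _ := by
        rw [Finset.sum_comm]
        refine Finset.sum_congr rfl fun d hd => ?_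
        rw [Finset.mem_Ioc] at hd
        rw [← Finset.sum_filter, sum_Ioc_filter_dvd (pow_pos hd.1 2), Finset.mul_sum]
        refine Finset.sum_congr rfl fun k _ => ?_
        push_cast
        rw [map_mul, mul_assoc]

theorem norm_sum_moebius_sq_mul_mulChar_le {n : ℕ} [Fact n.Prime] (χ : MulChar (ZMod n) ℂ)
    {s A : ℝ} (hs : 2 / 3 ≤ s) (hA : 0 ≤ A)
    (h : ∀ N : ℕ, ‖∑ k ∈ Finset.Ioc 0 N, χ (k : ZMod n)‖ ≤ A * (N : ℝ) ^ s)
    {x : ℝ} (hx : 0 ≤ x) :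
    ‖∑ m ∈ Finset.Ioc 0 ⌊x⌋₊,
        ((ArithmeticFunction.moebius m : ℤ) ^ 2 : ℂ) * χ (m : ZMod n)‖ ≤
      A * x ^ s * ∑' d : ℕ, 1 / (d : ℝ) ^ (4 / 3 : ℝ) := by
  rw [sum_moebius_sq_mul_mulChar]
  have hx' : 0 ≤ A * x ^ s := mul_nonneg hA (Real.rpow_nonneg hx s)
  calc _ ≤ ∑ d ∈ Finset.Ioc 0 ⌊x⌋₊, A * x ^ s * (1 / (d : ℝ) ^ (4 / 3 : ℝ)) := by
        refine norm_sum_le_of_le _ fun d hd => ?_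
        rw [Finset.mem_Ioc] at hd
        have hd1 : (1 : ℝ) ≤ d := by exact_mod_cast hd.1
        have hd0 : (0 : ℝ) < d := by linarith
        have hμ : ‖(ArithmeticFunction.moebius d : ℂ)‖ ≤ 1 := by
          rw [Complex.norm_intCast]
          exact_mod_cast ArithmeticFunction.abs_moebius_le_one
        have hdiv : ((⌊x⌋₊ / d ^ 2 : ℕ) : ℝ) ≤ x / (d : ℝ) ^ 2 := by
          refine Nat.cast_div_le.trans ?_
          push_cast
          gcongr
          exact Nat.floor_le hx
        have hpow : (d : ℝ) ^ (4 / 3 : ℝ) ≤ ((d : ℝ) ^ 2) ^ s := by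
          rw [← Real.rpow_natCast, ← Real.rpow_mul hd0.le]
          refine Real.rpow_le_rpow_of_exponent_le hd1 ?_
          push_cast
          linarith
        calc _ ≤ 1 * 1 * (A * ((⌊x⌋₊ / d ^ 2 : ℕ) : ℝ) ^ s) := by
              rw [norm_mul, norm_mul]
              gcongr
              · exact norm_mulChar_le_one χ _
              · exact h _
          _ ≤ A * (x / (d : ℝ) ^ 2) ^ s := by
              rw [one_mul, one_mul]
              gcongr
          _ = A * x ^ s * (1 / ((d : ℝ) ^ 2) ^ s) := by
              rw [Real.div_rpow hx (by positivity)]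
              ring
          _ ≤ _ := by gcongr
    _ ≤ _ := by
        rw [← Finset.mul_sum]
        gcongr
        exact (Real.summable_one_div_nat_rpow.mpr (by norm_num)).sum_le_tsum _
          fun d _ => by positivity

/-- Lemma 7: Burgess-type bound for character sums over square-free integers: for `r ≥ 3` and
nonprincipal `χ` mod `p`, `|∑_{m ≤ x} μ²(m) χ(m)| ≤ C(r) x^(1-1/r) p^((r+1)/(4r²)) (log p)^(1/(2r))`. -/
theorem squarefree_char_sum_burgess :
    ∀ r : ℕ, 3 ≤ r → ∃ C : ℝ, 0 < C ∧ ∀ (p : ℕ) [Fact p.Prime],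
      ∀ χ : DirichletCharacter ℂ p, χ ≠ 1 →
      ∀ x : ℝ, 2 ≤ x →
        ‖∑ m ∈ Finset.Icc 1 ⌊x⌋₊, ((ArithmeticFunction.moebius m : ℤ) ^ 2 : ℂ) * χ (m : ZMod p)‖
          ≤ C * x ^ (1 - 1 / (r : ℝ)) * (p : ℝ) ^ (((r : ℝ) + 1) / (4 * (r : ℝ) ^ 2))
            * (Real.log p) ^ (1 / (2 * (r : ℝ))) := by
  intro r hr
  obtain ⟨C, hC, hbound⟩ := exists_norm_sum_mulChar_le hr
  have hS : 0 < ∑' d : ℕ, 1 / (d : ℝ) ^ (4 / 3 : ℝ) :=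
    (Real.summable_one_div_nat_rpow.mpr (by norm_num)).tsum_pos (fun d => by positivity) 1
      (by norm_num)
  refine ⟨C * ∑' d : ℕ, 1 / (d : ℝ) ^ (4 / 3 : ℝ), mul_pos hC hS, ?_⟩
  intro p _ χ hχ x hx
  have hr3 : (3 : ℝ) ≤ r := by exact_mod_cast hr
  have hr0 : (r : ℝ) ≠ 0 := by positivity
  have hs : (2 / 3 : ℝ) ≤ 1 - (r : ℝ)⁻¹ := by
    have : (r : ℝ)⁻¹ ≤ 3⁻¹ := inv_anti₀ (by norm_num) hr3
    linarith
  have hlog : 0 ≤ Real.log p := Real.log_natCast_nonneg p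
  have key := norm_sum_moebius_sq_mul_mulChar_le χ (x := x) hs
    (A := C * (p : ℝ) ^ (((r : ℝ)⁻¹ + (r : ℝ)⁻¹ ^ 2) / 4) * Real.log p ^ ((r : ℝ)⁻¹ / 2))
    (by positivity) (fun N => by
      have := hbound p χ hχ 0 N
      rw [zero_add] at this
      linarith) (by linarith)
  have e1 : ((r : ℝ) + 1) / (4 * (r : ℝ) ^ 2) = ((r : ℝ)⁻¹ + (r : ℝ)⁻¹ ^ 2) / 4 := by
    field_simp
  have e2 : 1 / (2 * (r : ℝ)) = (r : ℝ)⁻¹ / 2 := by field_simp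
  rw [e1, e2, one_div]
  refine key.trans (le_of_eq ?_)
  ring
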